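/- There exist transcendental entire functions f, g : ℂ → ℂ, each with bounded singular set (i.e. f, g belong to the Eremenko–Lyubich class 𝓑), such that f and g are topologically equivalent, both have finite order, but ρ(f) ≠ ρ(g). -/

import Mathlib

open Complex Set Filter Topology Metric MeasureTheory
open scoped ENNReal Real

noncomputable def logPlus (x : ℝ) : ℝ := max 0 (Real.log x)

noncomputable def entireOrder (f : ℂ → ℂ) : ℝ≥0∞ :=
  Filter.limsup
    (fun z : ℂ => ENNReal.ofReal (logPlus (logPlus ‖f z‖) / Real.log ‖z‖))
    (Filter.comap (fun z : ℂ => ‖z‖) Filter.atTop)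

def IsRegularValue (f : ℂ → ℂ) (w : ℂ) : Prop :=
  ∃ U : Set ℂ, IsOpen U ∧ w ∈ U ∧
    ∀ z ∈ f ⁻¹' U,
      ∃ e : ↥(connectedComponentIn (f ⁻¹' U) z) ≃ₜ ↥U,
        ∀ x : ↥(connectedComponentIn (f ⁻¹' U) z), (e x : ℂ) = f ↑x

def singularSet (f : ℂ → ℂ) : Set ℂ := {w : ℂ | ¬ IsRegularValue f w}

def TranscendentalEntire (f : ℂ → ℂ) : Prop :=
  Differentiable ℂ f ∧ ¬ ∃ p : Polynomial ℂ, ∀ z, f z = p.eval z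

def TopEquiv (f g : ℂ → ℂ) : Prop :=
  ∃ φ ψ : ℂ ≃ₜ ℂ, ∀ z, ψ (f z) = g (φ z)

noncomputable def cylArea (A : Set ℂ) : ℝ≥0∞ :=
  ∫⁻ z in A, ENNReal.ofReal (1 / ‖z‖ ^ 2)

def AreaProperty (f : ℂ → ℂ) : Prop :=
  ∀ K : Set ℂ, IsCompact K → K ⊆ (singularSet f)ᶜ →
    cylArea (f ⁻¹' K \ Metric.ball (0 : ℂ) 1) < ⊤

/-- The principal branch of the square root. -/
noncomputable def principalSqrt (w : ℂ) : ℂ := exp (log w / 2)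

lemma principalSqrt_sq {w : ℂ} (hw : w ≠ 0) : principalSqrt w ^ 2 = w := by
  rw [principalSqrt, ← exp_nat_mul]
  rw [show ((2 : ℕ) : ℂ) * (log w / 2) = log w by push_cast; ring, exp_log hw]

lemma principalSqrt_re_nonneg (w : ℂ) : 0 ≤ (principalSqrt w).re := by
  rw [principalSqrt, exp_re]
  have him : (log w / 2).im = arg w / 2 := by
    rw [show (2 : ℂ) = ((2 : ℝ) : ℂ) by norm_num, div_ofReal_im, log_im]
  rw [him]
  refine mul_nonneg (Real.exp_pos _).le (Real.cos_nonneg_of_mem_Icc ⟨?_, ?_⟩)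
  · linarith [neg_pi_lt_arg w]
  · linarith [arg_le_pi w]

lemma ne_zero_of_norm_sub_one_lt {w : ℂ} (hw : ‖w - 1‖ < 1) : w ≠ 0 := by
  rintro rfl
  simp at hw

lemma continuousAt_principalSqrt {w : ℂ} (hw : ‖w - 1‖ < 1) : ContinuousAt principalSqrt w := by
  have : w ∈ slitPlane := by
    left
    have := (abs_re_le_norm (w - 1)).trans_lt hw
    rw [abs_lt] at this
    simp at this
    linarith
  unfold principalSqrt
  exact ((continuousAt_clog this).div_const 2).cexp

lemma norm_principalSqrt_sub_one_le {w : ℂ} (hw : ‖w - 1‖ < 1) :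
    ‖principalSqrt w - 1‖ ≤ ‖w - 1‖ := by
  have h1 : (principalSqrt w - 1) * (principalSqrt w + 1) = w - 1 := by
    linear_combination principalSqrt_sq (ne_zero_of_norm_sub_one_lt hw)
  have h2 : 1 ≤ ‖principalSqrt w + 1‖ := by
    have := re_le_norm (principalSqrt w + 1)
    have h3 := principalSqrt_re_nonneg w
    simp at this
    linarith
  rw [← h1, norm_mul]
  exact le_mul_of_one_le_right (norm_nonneg _) h2

/-- The quadratic polynomial with fixed points `α` and `1 - α`, of multipliers `2α` and
`2(1 - α)`, in the normalization where its critical point is `0`. -/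
noncomputable def quad (α : ℝ) (z : ℂ) : ℂ := z ^ 2 + (α - α ^ 2)

/-- The critical value of `quad α`. -/
noncomputable def critVal (α : ℝ) : ℂ := α - α ^ 2

lemma quad_sub_critVal (α : ℝ) (z : ℂ) : quad α z - critVal α = z ^ 2 := by
  simp [quad, critVal]

lemma quad_sub_fixed (α : ℝ) (z : ℂ) : quad α z - α = (z - α) * (z + α) := by
  simp only [quad]; ring

lemma continuous_quad (α : ℝ) : Continuous (quad α) := by unfold quad; fun_prop

/-- `h` differs from the translation taking `critVal α` to `critVal α'` by at most `ε` times the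
distance to the critical value. -/
def NearTranslation (α α' ε : ℝ) (h : ℂ → ℂ) : Prop :=
  ∀ w, ‖(h w - critVal α') - (w - critVal α)‖ ≤ ε * ‖w - critVal α‖

/-- The lift of `h` through the quadratic maps `quad α` and `quad α'` that is close to the
identity. -/
noncomputable def quadLift (α α' : ℝ) (h : ℂ → ℂ) (z : ℂ) : ℂ :=
  z * principalSqrt ((h (quad α z) - critVal α') / z ^ 2)

section Lift

variable {α α' ε : ℝ} {h g : ℂ → ℂ}

lemma NearTranslation.mono {δ : ℝ} (H : NearTranslation α α' ε h) (hδ : ε ≤ δ) :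
    NearTranslation α α' δ h := fun w =>
  (H w).trans (mul_le_mul_of_nonneg_right hδ (norm_nonneg _))

lemma NearTranslation.norm_ratio_sub_one_le (H : NearTranslation α α' ε h) {z : ℂ} (hz : z ≠ 0) :
    ‖(h (quad α z) - critVal α') / z ^ 2 - 1‖ ≤ ε := by
  have h2 : z ^ 2 ≠ 0 := pow_ne_zero 2 hz
  have := H (quad α z)
  rw [quad_sub_critVal] at this
  rw [div_sub_one h2, norm_div]
  exact (div_le_iff₀ (norm_pos_iff.2 h2)).2 this

lemma NearTranslation.map_critVal (H : NearTranslation α α' ε h) :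
    h (critVal α) = critVal α' := by
  have := H (critVal α)
  simp only [sub_self, norm_zero, mul_zero, norm_le_zero_iff, sub_zero] at this
  exact sub_eq_zero.1 this

lemma quadLift_zero : quadLift α α' h 0 = 0 := by simp [quadLift]

lemma quadLift_sq (H : NearTranslation α α' ε h) (hε : ε < 1) (z : ℂ) :
    quadLift α α' h z ^ 2 = h (quad α z) - critVal α' := by
  rcases eq_or_ne z 0 with rfl | hz
  · have : quad α 0 = critVal α := by simp [quad, critVal]
    rw [quadLift_zero, this, H.map_critVal]; simp
  · have := (H.norm_ratio_sub_one_le hz).trans_lt hε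
    rw [quadLift, mul_pow, principalSqrt_sq (ne_zero_of_norm_sub_one_lt this)]
    field_simp

lemma norm_quadLift_sub_le (H : NearTranslation α α' ε h) (hε : ε < 1) (z : ℂ) :
    ‖quadLift α α' h z - z‖ ≤ ε * ‖z‖ := by
  rcases eq_or_ne z 0 with rfl | hz
  · simp [quadLift_zero]
  · have h1 := H.norm_ratio_sub_one_le hz
    have h2 := (norm_principalSqrt_sub_one_le (h1.trans_lt hε)).trans h1
    rw [quadLift, ← mul_sub_one, norm_mul, mul_comm]
    gcongr

lemma continuous_quadLift (H : NearTranslation α α' ε h) (hε : ε < 1) (hc : Continuous h) :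
    Continuous (quadLift α α' h) := by
  rw [continuous_iff_continuousAt]
  intro z
  rcases eq_or_ne z 0 with rfl | hz
  · rw [ContinuousAt, quadLift_zero, tendsto_zero_iff_norm_tendsto_zero]
    refine squeeze_zero (g := fun z : ℂ => (ε + 1) * ‖z‖) (fun _ => norm_nonneg _) (fun z => ?_) ?_
    · have := norm_quadLift_sub_le H hε z
      have h2 := norm_le_norm_add_norm_sub' (quadLift α α' h z) z
      linarith
    · have : Continuous fun z : ℂ => (ε + 1) * ‖z‖ := by fun_prop
      simpa using this.tendsto 0
  · have h1 := (H.norm_ratio_sub_one_le hz).trans_lt hε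
    have h2 : ContinuousAt (fun z => (h (quad α z) - critVal α') / z ^ 2) z :=
      ((hc.comp (continuous_quad α)).continuousAt.sub continuousAt_const).div
        (continuousAt_id.pow 2) (pow_ne_zero 2 hz)
    exact continuousAt_id.mul (ContinuousAt.comp (f := fun z => (h (quad α z) - critVal α') / z ^ 2)
      (continuousAt_principalSqrt h1) h2)

/-- Two square roots of the same number near `z` coincide. -/
lemma eq_of_sq_eq_sq_of_near {a b z : ℂ} (hab : a ^ 2 = b ^ 2) (ha : ‖a - z‖ ≤ ‖z‖ / 2)
    (hb : ‖b - z‖ < ‖z‖) : a = b := by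
  rcases sq_eq_sq_iff_eq_or_eq_neg.1 hab with h | h
  · exact h
  · exfalso
    have h1 : ‖(2 : ℂ) * z‖ ≤ ‖a - z‖ + ‖b - z‖ := by
      rw [h, show (2 : ℂ) * z = -((-b - z) + (b - z)) by ring, norm_neg]
      exact norm_add_le _ _
    rw [norm_mul] at h1
    norm_num at h1
    have := norm_nonneg z
    linarith

lemma eq_quadLift (H : NearTranslation α α' ε h) (hε : ε ≤ 1 / 2) {z a : ℂ}
    (ha : a ^ 2 = h (quad α z) - critVal α') (haz : ‖a - z‖ ≤ ‖z‖ / 2) :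
    a = quadLift α α' h z := by
  rcases eq_or_ne z 0 with rfl | hz
  · rw [quadLift_zero]
    simpa using haz
  · refine eq_of_sq_eq_sq_of_near (ha.trans (quadLift_sq H (by linarith) z).symm) haz ?_
    have := norm_quadLift_sub_le H (by linarith) z
    have h2 := norm_pos_iff.2 hz
    nlinarith

/-- Lifting is contracting at points of modulus larger than `1/2`. -/
lemma norm_quadLift_sub_quadLift_le (H : NearTranslation α α' ε h) (G : NearTranslation α α' ε g)
    (hε : ε ≤ 1 / 10) (z : ℂ) :
    ‖quadLift α α' h z - quadLift α α' g z‖ * (9 / 5 * ‖z‖) ≤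
      ‖h (quad α z) - g (quad α z)‖ := by
  have h1 := norm_quadLift_sub_le H (by linarith) z
  have h2 := norm_quadLift_sub_le G (by linarith) z
  have h3 : (quadLift α α' h z - quadLift α α' g z) * (quadLift α α' h z + quadLift α α' g z) =
      h (quad α z) - g (quad α z) := by
    linear_combination quadLift_sq H (by linarith) z - quadLift_sq G (by linarith) z
  rw [← h3, norm_mul]
  refine mul_le_mul_of_nonneg_left ?_ (norm_nonneg _)
  have h4 : ‖(2 : ℂ) * z‖ ≤ ‖quadLift α α' h z + quadLift α α' g z‖ +
      (‖quadLift α α' h z - z‖ + ‖quadLift α α' g z - z‖) := by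
    rw [show (2 : ℂ) * z = (quadLift α α' h z + quadLift α α' g z) -
      ((quadLift α α' h z - z) + (quadLift α α' g z - z)) by ring]
    exact (norm_sub_le _ _).trans (by gcongr; exact norm_add_le _ _)
  rw [norm_mul] at h4
  norm_num at h4
  have := norm_nonneg z
  nlinarith

lemma norm_quadLift_sub_mul_le (H : NearTranslation α α' ε h) (hε : ε ≤ 1 / 10) (z : ℂ) :
    ‖quadLift α α' h z - z‖ * (9 / 5 * ‖z‖) ≤
      ‖h (quad α z) - quad α z‖ + ‖critVal α' - critVal α‖ := by
  have h1 := norm_quadLift_sub_le H (by linarith) z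
  have h3 : (quadLift α α' h z - z) * (quadLift α α' h z + z) =
      (h (quad α z) - quad α z) - (critVal α' - critVal α) := by
    linear_combination quadLift_sq H (by linarith) z + quad_sub_critVal α z
  refine le_trans ?_ (norm_sub_le _ _)
  rw [← h3, norm_mul]
  refine mul_le_mul_of_nonneg_left ?_ (norm_nonneg _)
  have h4 : ‖(2 : ℂ) * z‖ ≤ ‖quadLift α α' h z + z‖ + ‖quadLift α α' h z - z‖ := by
    rw [show (2 : ℂ) * z = (quadLift α α' h z + z) - (quadLift α α' h z - z) by ring]
    exact norm_sub_le _ _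
  rw [norm_mul] at h4
  norm_num at h4
  have := norm_nonneg z
  nlinarith

lemma quadLift_congr {z : ℂ} (hz : h (quad α z) = g (quad α z)) :
    quadLift α α' h z = quadLift α α' g z := by
  simp [quadLift, hz]

end Lift

/-- Coefficients of the power series `∑ linCoeff ρ n * z ^ (n + 1)` that conjugates
multiplication by `ρ` to `t ↦ ρ * t + t ^ 2`. -/
noncomputable def linCoeff (ρ : ℝ) : ℕ → ℝ
  | 0 => 1
  | n + 1 => (∑ i : Fin (n + 1), linCoeff ρ i * linCoeff ρ (n - i)) / (ρ ^ (n + 2) - ρ)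

lemma linCoeff_zero (ρ : ℝ) : linCoeff ρ 0 = 1 := by rw [linCoeff]

lemma linCoeff_succ (ρ : ℝ) (n : ℕ) :
    linCoeff ρ (n + 1) =
      (∑ ij ∈ Finset.HasAntidiagonal.antidiagonal n, linCoeff ρ ij.1 * linCoeff ρ ij.2) /
        (ρ ^ (n + 2) - ρ) := by
  rw [linCoeff, Finset.Nat.sum_antidiagonal_eq_sum_range_succ
    (fun x y => linCoeff ρ x * linCoeff ρ y) n, Finset.sum_range]

lemma abs_linCoeff_le_catalan {ρ A : ℝ} (hA0 : 0 ≤ A)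
    (hA : ∀ n : ℕ, 1 ≤ A * |ρ ^ (n + 2) - ρ|) (n : ℕ) :
    |linCoeff ρ n| ≤ A ^ n * catalan n := by
  induction n using Nat.strong_induction_on with
  | _ n ih =>
    rcases n with _ | n
    · simp [linCoeff_zero]
    · have hpos : 0 < |ρ ^ (n + 2) - ρ| := by
        by_contra hcon
        have h0 : |ρ ^ (n + 2) - ρ| = 0 := le_antisymm (not_lt.1 hcon) (abs_nonneg _)
        have := hA n
        rw [h0] at this
        norm_num at this
      rw [linCoeff_succ, abs_div, div_le_iff₀ hpos]
      calc |∑ ij ∈ Finset.HasAntidiagonal.antidiagonal n, linCoeff ρ ij.1 * linCoeff ρ ij.2|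
          ≤ ∑ ij ∈ Finset.HasAntidiagonal.antidiagonal n, |linCoeff ρ ij.1 * linCoeff ρ ij.2| :=
            Finset.abs_sum_le_sum_abs _ _
        _ ≤ ∑ ij ∈ Finset.HasAntidiagonal.antidiagonal n,
            A ^ n * (catalan ij.1 * catalan ij.2 : ℝ) := by
            refine Finset.sum_le_sum fun ij hij => ?_
            have hs : ij.1 + ij.2 = n := Finset.HasAntidiagonal.mem_antidiagonal.1 hij
            rw [abs_mul, ← hs, pow_add]
            calc |linCoeff ρ ij.1| * |linCoeff ρ ij.2|
                ≤ (A ^ ij.1 * catalan ij.1) * (A ^ ij.2 * catalan ij.2) :=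
                  mul_le_mul (ih _ (by omega)) (ih _ (by omega)) (abs_nonneg _) (by positivity)
              _ = _ := by ring
        _ = A ^ n * catalan (n + 1) := by
            rw [← Finset.mul_sum, catalan_succ']; push_cast; rfl
        _ ≤ A ^ n * catalan (n + 1) * (A * |ρ ^ (n + 2) - ρ|) :=
            le_mul_of_one_le_right (by positivity) (hA n)
        _ = A ^ (n + 1) * catalan (n + 1) * |ρ ^ (n + 2) - ρ| := by ring

lemma abs_linCoeff_le {ρ A : ℝ} (hA0 : 0 ≤ A)
    (hA : ∀ n : ℕ, 1 ≤ A * |ρ ^ (n + 2) - ρ|) (n : ℕ) :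
    |linCoeff ρ n| ≤ (4 * A) ^ n := by
  refine (abs_linCoeff_le_catalan hA0 hA n).trans ?_
  rw [mul_pow, mul_comm]
  gcongr
  have h1 : catalan n ≤ n.centralBinom := by
    rw [← succ_mul_catalan_eq_centralBinom]; exact Nat.le_mul_of_pos_left _ (by omega)
  exact_mod_cast h1.trans n.centralBinom_le_four_pow

lemma continuousAt_linCoeff {ρ : ℝ} (hρ : ∀ n : ℕ, ρ ^ (n + 2) - ρ ≠ 0) (n : ℕ) :
    ContinuousAt (fun ρ => linCoeff ρ n) ρ := by
  induction n using Nat.strong_induction_on with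
  | _ n ih =>
    rcases n with _ | n
    · simp only [linCoeff_zero]; exact continuousAt_const
    · simp only [linCoeff_succ]
      refine ContinuousAt.div ?_ (by fun_prop) (hρ n)
      refine tendsto_finsetSum _ fun ij hij => ?_
      have hs : ij.1 + ij.2 = n := Finset.HasAntidiagonal.mem_antidiagonal.1 hij
      exact (ih _ (by omega)).mul (ih _ (by omega))

/-- `f` differs from a translation by a map with Lipschitz constant `1/10` on the closed ball of
radius `R`. -/
def NearId (f : ℂ → ℂ) (R : ℝ) : Prop :=
  ∀ z w, ‖z‖ ≤ R → ‖w‖ ≤ R → ‖(f z - f w) - (z - w)‖ ≤ 1 / 10 * ‖z - w‖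

section NearId

variable {f : ℂ → ℂ} {R : ℝ}

lemma NearId.norm_sub_le (hf : NearId f R) {z w : ℂ} (hz : ‖z‖ ≤ R) (hw : ‖w‖ ≤ R) :
    ‖f z - f w‖ ≤ 11 / 10 * ‖z - w‖ := by
  have h1 := hf z w hz hw
  have h2 := norm_le_norm_add_norm_sub' (f z - f w) (z - w)
  linarith

lemma NearId.le_norm_sub (hf : NearId f R) {z w : ℂ} (hz : ‖z‖ ≤ R) (hw : ‖w‖ ≤ R) :
    9 / 10 * ‖z - w‖ ≤ ‖f z - f w‖ := by
  have h1 := hf z w hz hw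
  have h2 := norm_le_norm_add_norm_sub (f z - f w) (z - w)
  linarith

lemma NearId.injOn (hf : NearId f R) {z w : ℂ} (hz : ‖z‖ ≤ R) (hw : ‖w‖ ≤ R)
    (h : f z = f w) : z = w := by
  have := hf.le_norm_sub hz hw
  rw [h, sub_self, norm_zero] at this
  have h2 : ‖z - w‖ ≤ 0 := by linarith
  exact sub_eq_zero.1 (norm_le_zero_iff.1 h2)

lemma NearId.exists_eq (hf : NearId f R) (hR : 0 ≤ R) {y : ℂ}
    (hy : ‖y - f 0‖ ≤ 9 / 10 * R) : ∃ z, ‖z‖ ≤ R ∧ f z = y := by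
  have h1 : ApproximatesLinearOn f (ContinuousLinearMap.id ℂ ℂ) (closedBall 0 R)
      (1 / 10 : NNReal) := by
    intro z hz w hw
    have := hf z w (by simpa using hz) (by simpa using hw)
    simpa using this
  let e : (ContinuousLinearMap.id ℂ ℂ).NonlinearRightInverse :=
    { toFun := id, nnnorm := 1, bound' := by simp, right_inv' := by simp }
  have h2 := h1.surjOn_closedBall_of_nonlinearRightInverse e hR subset_rfl
  obtain ⟨z, hz, hzy⟩ := h2 (show y ∈ closedBall (f 0) _ by
    rw [mem_closedBall, dist_eq_norm]
    refine hy.trans (le_of_eq ?_)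
    simp only [e]
    norm_num)
  exact ⟨z, by simpa using hz, hzy⟩

end NearId

lemma norm_pow_succ_sub_pow_succ_le {z w : ℂ} {R : ℝ} (hz : ‖z‖ ≤ R) (hw : ‖w‖ ≤ R) (n : ℕ) :
    ‖z ^ (n + 1) - w ^ (n + 1)‖ ≤ (n + 1) * R ^ n * ‖z - w‖ := by
  have hR := (norm_nonneg z).trans hz
  induction n with
  | zero => simp
  | succ n ih =>
    have : z ^ (n + 1 + 1) - w ^ (n + 1 + 1) =
        z * (z ^ (n + 1) - w ^ (n + 1)) + (z - w) * w ^ (n + 1) := by ring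
    rw [this]
    calc _ ≤ ‖z * (z ^ (n + 1) - w ^ (n + 1))‖ + ‖(z - w) * w ^ (n + 1)‖ := norm_add_le _ _
      _ ≤ R * ((n + 1) * R ^ n * ‖z - w‖) + ‖z - w‖ * R ^ (n + 1) := by
        rw [norm_mul, norm_mul, norm_pow]
        gcongr
      _ = _ := by push_cast; ring

/-- Lipschitz estimate for power series without constant term. -/
lemma norm_tsum_pow_sub_tsum_pow_le {d : ℕ → ℂ} {R : ℝ} (hR : 0 ≤ R)
    (hd : Summable fun n : ℕ => (n + 1) * ‖d n‖ * R ^ n) {z w : ℂ} (hz : ‖z‖ ≤ R) (hw : ‖w‖ ≤ R) :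
    (Summable fun n : ℕ => d n * z ^ (n + 1)) ∧
    ‖(∑' n, d n * z ^ (n + 1)) - ∑' n, d n * w ^ (n + 1)‖ ≤
      (∑' n : ℕ, (n + 1) * ‖d n‖ * R ^ n) * ‖z - w‖ := by
  have key : ∀ v : ℂ, ‖v‖ ≤ R → Summable fun n : ℕ => d n * v ^ (n + 1) := by
    intro v hv
    refine Summable.of_norm_bounded (hd.mul_right R) fun n => ?_
    rw [norm_mul, norm_pow, pow_succ]
    calc ‖d n‖ * (‖v‖ ^ n * ‖v‖) ≤ ‖d n‖ * (R ^ n * R) := by gcongr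
      _ ≤ (n + 1) * (‖d n‖ * (R ^ n * R)) :=
        le_mul_of_one_le_left (by positivity) (by linarith [n.cast_nonneg (α := ℝ)])
      _ = _ := by ring
  refine ⟨key z hz, ?_⟩
  rw [← (key z hz).tsum_sub (key w hw), ← tsum_mul_right]
  refine tsum_of_norm_bounded (hd.mul_right _).hasSum fun n => ?_
  rw [← mul_sub, norm_mul]
  calc ‖d n‖ * ‖z ^ (n + 1) - w ^ (n + 1)‖ ≤ ‖d n‖ * ((n + 1) * R ^ n * ‖z - w‖) := by
        gcongr; exact norm_pow_succ_sub_pow_succ_le hz hw n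
    _ = _ := by ring

/-- The series conjugating multiplication by `ρ` to `t ↦ ρ * t + t ^ 2`. -/
noncomputable def linSeries (ρ : ℝ) (z : ℂ) : ℂ := ∑' n, (linCoeff ρ n : ℂ) * z ^ (n + 1)

lemma linSeries_zero (ρ : ℝ) : linSeries ρ 0 = 0 := by simp [linSeries]

lemma hasSum_succ_mul_geometric {x : ℝ} (hx0 : 0 ≤ x) (hx : x < 1) :
    HasSum (fun n : ℕ => (n + 1) * x ^ n) (1 / (1 - x) ^ 2) := by
  have h1 : ‖x‖ < 1 := by rwa [Real.norm_of_nonneg hx0]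
  have h := (hasSum_coe_mul_geometric_of_norm_lt_one h1).add (hasSum_geometric_of_norm_lt_one h1)
  have hne : 1 - x ≠ 0 := by linarith
  have h1 : 1 / (1 - x) ^ 2 = x / (1 - x) ^ 2 + (1 - x)⁻¹ := by field_simp; ring
  simpa only [h1, add_one_mul] using h

section Series

variable {ρ K R : ℝ}

lemma norm_linSeries_term_le (hb : ∀ n, |linCoeff ρ n| ≤ K ^ n) (hK : 0 ≤ K) (n : ℕ) {z : ℂ}
    (hz : ‖z‖ ≤ R) : ‖(linCoeff ρ n : ℂ) * z ^ (n + 1)‖ ≤ R * (K * R) ^ n := by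
  have hR := (norm_nonneg z).trans hz
  rw [norm_mul, norm_pow, norm_real, Real.norm_eq_abs]
  calc |linCoeff ρ n| * ‖z‖ ^ (n + 1) ≤ K ^ n * R ^ (n + 1) := by gcongr; exact hb n
    _ = _ := by ring

lemma summable_linSeries (hb : ∀ n, |linCoeff ρ n| ≤ K ^ n) (hK : 0 ≤ K) (hR : 0 ≤ R)
    (hKR : K * R < 1) {z : ℂ} (hz : ‖z‖ ≤ R) :
    Summable fun n => ‖(linCoeff ρ n : ℂ) * z ^ (n + 1)‖ :=
  Summable.of_nonneg_of_le (fun _ => norm_nonneg _) (fun n => norm_linSeries_term_le hb hK n hz)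
    ((summable_geometric_of_lt_one (by positivity) hKR).mul_left R)

lemma differentiableOn_linSeries (hb : ∀ n, |linCoeff ρ n| ≤ K ^ n) (hK : 0 ≤ K) (hR : 0 ≤ R)
    (hKR : K * R < 1) : DifferentiableOn ℂ (linSeries ρ) (ball 0 R) :=
  differentiableOn_tsum_of_summable_norm
    ((summable_geometric_of_lt_one (by positivity) hKR).mul_left R)
    (fun n => by fun_prop) isOpen_ball
    (fun n w hw => norm_linSeries_term_le hb hK n (by simpa using (mem_ball.1 hw).le))

lemma linSeries_mul (hb : ∀ n, |linCoeff ρ n| ≤ K ^ n) (hK : 0 ≤ K) (hR : 0 ≤ R)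
    (hKR : K * R < 1) (hρ : ∀ n : ℕ, ρ ^ (n + 2) - ρ ≠ 0) {z : ℂ} (hz : ‖z‖ ≤ R)
    (hρz : ‖ρ * z‖ ≤ R) :
    linSeries ρ (ρ * z) = ρ * linSeries ρ z + linSeries ρ z ^ 2 := by
  have s1 := summable_linSeries hb hK hR hKR hz
  have s2 := summable_linSeries hb hK hR hKR hρz
  have hsq : linSeries ρ z ^ 2 = ∑' n, ∑ kl ∈ Finset.HasAntidiagonal.antidiagonal n,
      ((linCoeff ρ kl.1 : ℂ) * z ^ (kl.1 + 1)) * ((linCoeff ρ kl.2 : ℂ) * z ^ (kl.2 + 1)) := by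
    rw [sq]; exact tsum_mul_tsum_eq_tsum_sum_antidiagonal_of_summable_norm s1 s1
  have hterm : ∀ n, ∑ kl ∈ Finset.HasAntidiagonal.antidiagonal n,
      ((linCoeff ρ kl.1 : ℂ) * z ^ (kl.1 + 1)) * ((linCoeff ρ kl.2 : ℂ) * z ^ (kl.2 + 1)) =
      (linCoeff ρ (n + 1) : ℂ) * (ρ * z) ^ (n + 1 + 1) -
        ρ * ((linCoeff ρ (n + 1) : ℂ) * z ^ (n + 1 + 1)) := by
    intro n
    have h1 : linCoeff ρ (n + 1) * (ρ ^ (n + 2) - ρ) =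
        ∑ ij ∈ Finset.HasAntidiagonal.antidiagonal n, linCoeff ρ ij.1 * linCoeff ρ ij.2 := by
      rw [linCoeff_succ, div_mul_cancel₀ _ (hρ n)]
    have h2 : (linCoeff ρ (n + 1) : ℂ) * ((ρ : ℂ) ^ (n + 2) - ρ) =
        ∑ ij ∈ Finset.HasAntidiagonal.antidiagonal n, (linCoeff ρ ij.1 : ℂ) * linCoeff ρ ij.2 := by
      exact_mod_cast congrArg (fun x : ℝ => (x : ℂ)) h1
    calc _ = ∑ kl ∈ Finset.HasAntidiagonal.antidiagonal n,
          ((linCoeff ρ kl.1 : ℂ) * linCoeff ρ kl.2) * z ^ (n + 2) := by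
          refine Finset.sum_congr rfl fun kl hkl => ?_
          rw [← Finset.HasAntidiagonal.mem_antidiagonal.1 hkl]
          ring
      _ = _ := by rw [← Finset.sum_mul, ← h2]; ring
  have e1 : linSeries ρ (ρ * z) =
      ρ * z + ∑' n, (linCoeff ρ (n + 1) : ℂ) * (ρ * z) ^ (n + 1 + 1) := by
    rw [linSeries, s2.of_norm.tsum_eq_zero_add]
    simp [linCoeff_zero]
  have e2 : linSeries ρ z = z + ∑' n, (linCoeff ρ (n + 1) : ℂ) * z ^ (n + 1 + 1) := by
    rw [linSeries, s1.of_norm.tsum_eq_zero_add]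
    simp [linCoeff_zero]
  have t1 := (summable_nat_add_iff 1).2 s1.of_norm
  have t2 := (summable_nat_add_iff 1).2 s2.of_norm
  rw [hsq, tsum_congr hterm, t2.tsum_sub (t1.mul_left _), tsum_mul_left, e1]
  nth_rewrite 1 [e2]
  ring

lemma nearId_linSeries (hb : ∀ n, |linCoeff ρ n| ≤ K ^ n) (hK : 0 ≤ K) (hR : 0 ≤ R)
    (hKR : K * R ≤ 1 / 40) : NearId (linSeries ρ) R := by
  intro z w hz hw
  have hx0 : 0 ≤ K * R := by positivity
  have hg := hasSum_succ_mul_geometric hx0 (by linarith)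
  have hle : ∀ n : ℕ, (n + 1) * ‖(if n = 0 then 0 else (linCoeff ρ n : ℂ))‖ * R ^ n ≤
      (n + 1) * (K * R) ^ n - if n = 0 then 1 else 0 := by
    intro n
    split_ifs with h
    · simp [h]
    · rw [norm_real, Real.norm_eq_abs, mul_pow, sub_zero, ← mul_assoc]
      gcongr
      exact hb n
  have hg' := hg.sub (hasSum_ite_eq 0 (1 : ℝ))
  have hs : Summable fun n : ℕ =>
      (n + 1) * ‖(if n = 0 then 0 else (linCoeff ρ n : ℂ))‖ * R ^ n :=
    Summable.of_nonneg_of_le (fun n => by positivity) hle hg'.summable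
  have hmain := (norm_tsum_pow_sub_tsum_pow_le hR hs hz hw).2
  have hsplit : ∀ v : ℂ, ‖v‖ ≤ R → linSeries ρ v - v =
      ∑' n : ℕ, (if n = 0 then 0 else (linCoeff ρ n : ℂ)) * v ^ (n + 1) := by
    intro v hv
    have s1 := (summable_linSeries hb hK hR (by linarith) hv).of_norm
    have h1 := (norm_tsum_pow_sub_tsum_pow_le hR hs hv hv).1
    rw [linSeries, s1.tsum_eq_zero_add, h1.tsum_eq_zero_add]
    simp [linCoeff_zero]
  have hval : (∑' n : ℕ, (n + 1) * ‖(if n = 0 then 0 else (linCoeff ρ n : ℂ))‖ * R ^ n) ≤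
      1 / 10 := by
    refine (hs.tsum_le_tsum hle hg'.summable).trans ?_
    rw [hg'.tsum_eq, sub_le_iff_le_add, div_le_iff₀ (by nlinarith)]
    nlinarith
  rw [show linSeries ρ z - linSeries ρ w - (z - w) =
    (linSeries ρ z - z) - (linSeries ρ w - w) by ring, hsplit z hz, hsplit w hw]
  exact hmain.trans (by gcongr)

end Series

/-- The radial homeomorphism `u ↦ u * ‖u‖ ^ (s - 1)`. -/
noncomputable def powStretch (s : ℝ) (u : ℂ) : ℂ := u * ((‖u‖ ^ (s - 1) : ℝ) : ℂ)

section PowStretch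

variable {s : ℝ}

lemma powStretch_zero : powStretch s 0 = 0 := by simp [powStretch]

lemma norm_powStretch (hs : s ≠ 0) (u : ℂ) : ‖powStretch s u‖ = ‖u‖ ^ s := by
  rcases eq_or_ne u 0 with rfl | hu
  · simp [powStretch_zero, Real.zero_rpow hs]
  · have h := norm_pos_iff.2 hu
    rw [powStretch, norm_mul, norm_real, Real.norm_of_nonneg (by positivity),
      Real.rpow_sub_one h.ne']
    field_simp

lemma continuous_powStretch (hs : 0 < s) : Continuous (powStretch s) := by
  rw [continuous_iff_continuousAt]
  intro u
  rcases eq_or_ne u 0 with rfl | hu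
  · rw [ContinuousAt, powStretch_zero, tendsto_zero_iff_norm_tendsto_zero]
    simp only [norm_powStretch hs.ne']
    have : ContinuousAt (fun u : ℂ => ‖u‖ ^ s) 0 :=
      continuousAt_id.norm.rpow_const (Or.inr hs.le)
    simpa [ContinuousAt, Real.zero_rpow hs.ne'] using this
  · have : ContinuousAt (fun u : ℂ => ‖u‖ ^ (s - 1)) u :=
      continuousAt_id.norm.rpow_const (Or.inl (norm_ne_zero_iff.2 hu))
    exact continuousAt_id.mul (continuous_ofReal.continuousAt.comp this)

lemma powStretch_mul_of_pos {a : ℝ} (ha : 0 < a) (u : ℂ) :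
    powStretch s (a * u) = ((a ^ s : ℝ) : ℂ) * powStretch s u := by
  simp only [powStretch, norm_mul, norm_real, Real.norm_of_nonneg ha.le]
  rw [Real.mul_rpow ha.le (norm_nonneg _), Real.rpow_sub_one ha.ne']
  have := ofReal_ne_zero.2 ha.ne'
  push_cast
  field_simp

lemma powStretch_inv_powStretch (hs : 0 < s) (u : ℂ) :
    powStretch s⁻¹ (powStretch s u) = u := by
  rcases eq_or_ne u 0 with rfl | hu
  · simp [powStretch_zero]
  · have h := norm_pos_iff.2 hu
    rw [powStretch, norm_powStretch hs.ne', powStretch, mul_assoc, ← ofReal_mul,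
      ← Real.rpow_mul h.le, ← Real.rpow_add h]
    have : s - 1 + s * (s⁻¹ - 1) = 0 := by field_simp; ring
    rw [this]; simp

lemma abs_rpow_sub_self_le (hs0 : 0 ≤ s) (hs2 : s ≤ 2) {x : ℝ} (hx0 : 0 ≤ x) (hx4 : x ≤ 4) :
    |x ^ s - x| ≤ 4 * |s - 1| * |x - 1| := by
  have hx1 : (1 : ℝ) + (x - 1) = x := by ring
  rcases le_total 1 s with hs | hs <;> rcases le_total x 1 with hx | hx
  · have h1 := one_add_mul_self_le_rpow_one_add (s := x - 1) (by linarith) hs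
    rw [hx1] at h1
    have h2 : x ^ s ≤ x := by
      rcases hx0.eq_or_lt with rfl | hx0
      · rw [Real.zero_rpow (by linarith)]
      · simpa using Real.rpow_le_rpow_of_exponent_ge hx0 hx hs
    rw [abs_of_nonpos (by linarith), abs_of_nonneg (by linarith), abs_of_nonpos (by linarith)]
    nlinarith [mul_nonneg (sub_nonneg.2 hs) (sub_nonneg.2 hx)]
  · have h1 := rpow_one_add_le_one_add_mul_self (s := x - 1) (by linarith) (p := s - 1)
      (by linarith) (by linarith)
    rw [hx1] at h1
    have h2 : x ^ s = x * x ^ (s - 1) := by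
      rw [Real.rpow_sub_one (by linarith)]; field_simp
    have h3 : 1 ≤ x ^ (s - 1) := Real.one_le_rpow hx (by linarith)
    have h4 : x ^ s - x = x * (x ^ (s - 1) - 1) := by rw [h2]; ring
    rw [h4, abs_of_nonneg (mul_nonneg hx0 (by linarith)), abs_of_nonneg (by linarith),
      abs_of_nonneg (by linarith), mul_assoc]
    exact mul_le_mul hx4 (by linarith) (by linarith) (by norm_num)
  · have h1 := rpow_one_add_le_one_add_mul_self (s := x - 1) (by linarith) (p := s)
      hs0 hs
    rw [hx1] at h1
    have h2 : x ≤ x ^ s := by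
      rcases hx0.eq_or_lt with rfl | hx0
      · exact Real.rpow_nonneg le_rfl _
      · simpa using Real.rpow_le_rpow_of_exponent_ge hx0 hx hs
    rw [abs_of_nonneg (by linarith), abs_of_nonpos (by linarith), abs_of_nonpos (by linarith)]
    nlinarith [mul_nonneg (sub_nonneg.2 hs) (sub_nonneg.2 hx)]
  · have h1 := rpow_one_add_le_one_add_mul_self (s := x - 1) (by linarith) (p := 1 - s)
      (by linarith) (by linarith)
    rw [hx1] at h1
    have hxs : x ^ s ≤ x := by
      simpa using Real.rpow_le_rpow_of_exponent_le hx hs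
    have h2 : x = x ^ s * x ^ (1 - s) := by
      rw [← Real.rpow_add (by linarith)]; simp
    have h3 : 1 ≤ x ^ (1 - s) := Real.one_le_rpow hx (by linarith)
    have h4 : x - x ^ s = x ^ s * (x ^ (1 - s) - 1) := by
      linear_combination h2
    rw [abs_sub_comm, h4, abs_of_nonneg (mul_nonneg (by positivity) (by linarith)),
      abs_of_nonpos (by linarith), abs_of_nonneg (by linarith), mul_assoc]
    exact mul_le_mul (hxs.trans hx4) (by linarith) (by linarith) (by norm_num)

lemma norm_powStretch_sub_self_le (hs0 : 0 < s) (hs2 : s ≤ 2) {u : ℂ} (hu : ‖u‖ ≤ 4) :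
    ‖powStretch s u - u‖ ≤ 4 * |s - 1| * ‖u - 1‖ := by
  have h1 : ‖powStretch s u - u‖ = |‖u‖ ^ s - ‖u‖| := by
    rcases eq_or_ne u 0 with rfl | hu0
    · simp [powStretch_zero, Real.zero_rpow hs0.ne']
    · have h := norm_pos_iff.2 hu0
      rw [powStretch, ← mul_sub_one, norm_mul, ← ofReal_one, ← ofReal_sub, norm_real,
        Real.norm_eq_abs]
      nth_rewrite 1 [← abs_of_pos h]
      rw [← abs_mul, Real.rpow_sub_one h.ne']
      congr 1
      field_simp
  rw [h1]
  refine (abs_rpow_sub_self_le hs0.le hs2 (norm_nonneg _) hu).trans ?_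
  gcongr
  simpa using abs_norm_sub_norm_le u 1

end PowStretch

/-- The range of the parameter. -/
def IsParam (α : ℝ) : Prop := 9 / 10 ^ 4 ≤ α ∧ α ≤ 11 / 10 ^ 4

namespace IsParam

variable {α : ℝ}

lemma two_mul_pow_sub_neg (hα : IsParam α) (n : ℕ) :
    1 ≤ 600 * |(2 * α) ^ (n + 2) - 2 * α| ∧ (2 * α) ^ (n + 2) - 2 * α ≠ 0 := by
  obtain ⟨h1, h2⟩ := hα
  norm_num at h1 h2
  have h3 : (2 * α) ^ (n + 1) ≤ 2 * α := by
    simpa using pow_le_pow_of_le_one (show 0 ≤ 2 * α by linarith) (by linarith)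
      (Nat.le_add_left 1 n)
  have h4 : (2 * α) ^ (n + 2) - 2 * α = 2 * α * ((2 * α) ^ (n + 1) - 1) := by ring
  have h5 : (2 * α) ^ (n + 1) - 1 ≤ -(99 / 100) := by linarith
  have h6 : (2 * α) ^ (n + 2) - 2 * α ≤ -(1 / 600) := by rw [h4]; nlinarith
  refine ⟨?_, by linarith⟩
  rw [abs_of_nonpos (by linarith)]
  linarith

lemma abs_linCoeff_le (hα : IsParam α) (n : ℕ) : |linCoeff (2 * α) n| ≤ 2400 ^ n := by
  have := _root_.abs_linCoeff_le (by norm_num) (fun n => (hα.two_mul_pow_sub_neg n).1) n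
  norm_num at this
  exact this

lemma nearId (hα : IsParam α) : NearId (linSeries (2 * α)) (1 / 10 ^ 5) :=
  nearId_linSeries hα.abs_linCoeff_le (by norm_num) (by norm_num) (by norm_num)

lemma norm_linSeries_le (hα : IsParam α) {w : ℂ} (hw : ‖w‖ ≤ 1 / 10 ^ 5) :
    ‖linSeries (2 * α) w‖ ≤ 11 / 10 * ‖w‖ := by
  simpa [linSeries_zero] using hα.nearId.norm_sub_le hw (w := 0) (by simp)

lemma le_norm_linSeries (hα : IsParam α) {w : ℂ} (hw : ‖w‖ ≤ 1 / 10 ^ 5) :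
    9 / 10 * ‖w‖ ≤ ‖linSeries (2 * α) w‖ := by
  simpa [linSeries_zero] using hα.nearId.le_norm_sub hw (w := 0) (by simp)

lemma linSeries_mul (hα : IsParam α) {w : ℂ} (hw : ‖w‖ ≤ 1 / 10 ^ 5) :
    linSeries (2 * α) (((2 * α : ℝ) : ℂ) * w) =
      ((2 * α : ℝ) : ℂ) * linSeries (2 * α) w + linSeries (2 * α) w ^ 2 := by
  refine _root_.linSeries_mul hα.abs_linCoeff_le (by norm_num) (by norm_num) (by norm_num)
    (fun n => (hα.two_mul_pow_sub_neg n).2) hw ?_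
  obtain ⟨h1, h2⟩ := hα
  norm_num at h1 h2
  rw [norm_mul, norm_real, Real.norm_of_nonneg (by linarith)]
  nlinarith [norm_nonneg w]

end IsParam

/-- The Koenigs coordinate of `quad α` at the attracting fixed point, translated to `0`. -/
noncomputable def koenigs (α : ℝ) (t : ℂ) : ℂ :=
  Function.invFunOn (linSeries (2 * α)) (closedBall 0 (1 / 10 ^ 5)) t

section Koenigs

variable {α : ℝ}

lemma koenigs_spec (hα : IsParam α) {t : ℂ} (ht : ‖t‖ ≤ 9 / 10 ^ 6) :
    ‖koenigs α t‖ ≤ 1 / 10 ^ 5 ∧ linSeries (2 * α) (koenigs α t) = t := by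
  obtain ⟨w, hw, hwt⟩ := hα.nearId.exists_eq (y := t) (by norm_num) (by
    rw [linSeries_zero, sub_zero]; norm_num at ht ⊢; exact ht)
  have h : ∃ w ∈ closedBall (0 : ℂ) (1 / 10 ^ 5), linSeries (2 * α) w = t :=
    ⟨w, by simpa using hw, hwt⟩
  exact ⟨mem_closedBall_zero_iff.1 (Function.invFunOn_mem h), Function.invFunOn_eq h⟩

lemma koenigs_eq (hα : IsParam α) {t w : ℂ} (ht : ‖t‖ ≤ 9 / 10 ^ 6) (hw : ‖w‖ ≤ 1 / 10 ^ 5)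
    (h : linSeries (2 * α) w = t) : koenigs α t = w :=
  hα.nearId.injOn (koenigs_spec hα ht).1 hw ((koenigs_spec hα ht).2.trans h.symm)

lemma norm_koenigs_le (hα : IsParam α) {t : ℂ} (ht : ‖t‖ ≤ 9 / 10 ^ 6) :
    ‖koenigs α t‖ ≤ 10 / 9 * ‖t‖ := by
  obtain ⟨h1, h2⟩ := koenigs_spec hα ht
  have := hα.le_norm_linSeries h1
  rw [h2] at this
  linarith

lemma le_norm_koenigs (hα : IsParam α) {t : ℂ} (ht : ‖t‖ ≤ 9 / 10 ^ 6) :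
    10 / 11 * ‖t‖ ≤ ‖koenigs α t‖ := by
  obtain ⟨h1, h2⟩ := koenigs_spec hα ht
  have := hα.norm_linSeries_le h1
  rw [h2] at this
  linarith

lemma koenigs_zero (hα : IsParam α) : koenigs α 0 = 0 :=
  koenigs_eq hα (by norm_num) (by norm_num) (linSeries_zero _)

lemma continuousOn_koenigs (hα : IsParam α) :
    ContinuousOn (koenigs α) (closedBall 0 (9 / 10 ^ 6)) := by
  refine (LipschitzOnWith.of_dist_le_mul (K := 2) fun t ht t' ht' => ?_).continuousOn
  rw [mem_closedBall_zero_iff] at ht ht'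
  obtain ⟨h1, h2⟩ := koenigs_spec hα ht
  obtain ⟨h1', h2'⟩ := koenigs_spec hα ht'
  have := hα.nearId.le_norm_sub h1 h1'
  rw [h2, h2'] at this
  rw [dist_eq_norm, dist_eq_norm]
  norm_num
  linarith [norm_nonneg (koenigs α t - koenigs α t')]

lemma koenigs_mul_add_sq (hα : IsParam α) {t : ℂ} (ht : ‖t‖ ≤ 9 / 10 ^ 6) :
    koenigs α (t * (t + 2 * α)) = ((2 * α : ℝ) : ℂ) * koenigs α t := by
  obtain ⟨h1, h2⟩ := koenigs_spec hα ht
  obtain ⟨ha, hb⟩ := id hα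
  norm_num at ha hb ht h1
  refine koenigs_eq hα ?_ ?_ ?_
  · have h3 : ‖t + 2 * α‖ ≤ ‖t‖ + 2 * α := by
      refine (norm_add_le _ _).trans (le_of_eq ?_)
      rw [norm_mul, norm_real, Real.norm_of_nonneg (by linarith)]; norm_num
    rw [norm_mul]
    norm_num
    nlinarith [norm_nonneg t, mul_le_mul_of_nonneg_left h3 (norm_nonneg t)]
  · rw [norm_mul, norm_real, Real.norm_of_nonneg (by linarith)]
    norm_num
    nlinarith [norm_nonneg (koenigs α t)]
  · rw [hα.linSeries_mul (by norm_num; exact h1), h2]; push_cast; ring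

end Koenigs

/-- The Koenigs coordinate of the critical value of `quad α`. -/
noncomputable def koenigsCritVal (α : ℝ) : ℂ := koenigs α (-(α : ℂ) ^ 2)

section KoenigsCritVal

variable {α : ℝ}

lemma norm_neg_sq_bounds (hα : IsParam α) :
    81 / 10 ^ 8 ≤ ‖-(α : ℂ) ^ 2‖ ∧ ‖-(α : ℂ) ^ 2‖ ≤ 121 / 10 ^ 8 := by
  obtain ⟨ha, hb⟩ := hα
  norm_num at ha hb
  rw [norm_neg, norm_pow, norm_real, Real.norm_of_nonneg (by linarith)]
  norm_num
  constructor <;> nlinarith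

lemma koenigsCritVal_bounds (hα : IsParam α) :
    73 / 10 ^ 8 ≤ ‖koenigsCritVal α‖ ∧ ‖koenigsCritVal α‖ ≤ 135 / 10 ^ 8 := by
  obtain ⟨h1, h2⟩ := norm_neg_sq_bounds hα
  have h3 : ‖-(α : ℂ) ^ 2‖ ≤ 9 / 10 ^ 6 := h2.trans (by norm_num)
  have h4 := norm_koenigs_le hα h3
  have h5 := le_norm_koenigs hα h3
  rw [koenigsCritVal]
  norm_num at *
  constructor <;> linarith

lemma linSeries_koenigsCritVal (hα : IsParam α) :
    linSeries (2 * α) (koenigsCritVal α) = -(α : ℂ) ^ 2 :=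
  (koenigs_spec hα ((norm_neg_sq_bounds hα).2.trans (by norm_num))).2

end KoenigsCritVal

/-- Taylor coefficients of the inverse Koenigs coordinate, in the coordinate that is `1` at the
critical value. -/
noncomputable def critCoeff (α : ℝ) (n : ℕ) : ℂ := linCoeff (2 * α) n * koenigsCritVal α ^ (n + 1)

/-- A weighted distance between the coefficient sequences `critCoeff`. -/
noncomputable def coeffDist (α α' : ℝ) : ℝ :=
  ∑' n : ℕ, (n + 1) * ‖critCoeff α n - critCoeff α' n‖ * 4 ^ n

section CoeffDist

variable {α α' : ℝ}

lemma coeffDist_comm (α α' : ℝ) : coeffDist α α' = coeffDist α' α := by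
  simp only [coeffDist, norm_sub_rev]

lemma norm_critCoeff_le (hα : IsParam α) (n : ℕ) : ‖critCoeff α n‖ ≤ (1 / 100) ^ n := by
  have h := (koenigsCritVal_bounds hα).2
  rw [critCoeff, norm_mul, norm_pow, norm_real, Real.norm_eq_abs, pow_succ, ← mul_assoc]
  calc |linCoeff (2 * α) n| * ‖koenigsCritVal α‖ ^ n * ‖koenigsCritVal α‖
      ≤ 2400 ^ n * (1 / 240000) ^ n * 1 := by
        gcongr
        · exact hα.abs_linCoeff_le n
        · exact h.trans (by norm_num)
        · exact h.trans (by norm_num)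
    _ = _ := by rw [← mul_pow]; norm_num

lemma coeffDist_term_le (hα : IsParam α) (hα' : IsParam α') (n : ℕ) :
    (n + 1) * ‖critCoeff α n - critCoeff α' n‖ * 4 ^ n ≤ 2 * ((n + 1) * (1 / 25) ^ n) := by
  have h1 : ‖critCoeff α n - critCoeff α' n‖ ≤ 2 * (1 / 100) ^ n := by
    refine (norm_sub_le _ _).trans ?_
    linarith [norm_critCoeff_le hα n, norm_critCoeff_le hα' n]
  calc (n + 1) * ‖critCoeff α n - critCoeff α' n‖ * 4 ^ n
      ≤ (n + 1) * (2 * (1 / 100) ^ n) * 4 ^ n := by gcongr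
    _ = 2 * ((n + 1) * ((1 / 100) ^ n * 4 ^ n)) := by ring
    _ = _ := by rw [← mul_pow]; norm_num

lemma summable_coeffDist_bound : Summable fun n : ℕ => 2 * (((n : ℝ) + 1) * (1 / 25) ^ n) :=
  (hasSum_succ_mul_geometric (by norm_num) (by norm_num)).summable.mul_left 2

lemma summable_coeffDist (hα : IsParam α) (hα' : IsParam α') :
    Summable fun n : ℕ => (n + 1) * ‖critCoeff α n - critCoeff α' n‖ * 4 ^ n :=
  Summable.of_nonneg_of_le (fun _ => by positivity) (coeffDist_term_le hα hα')
    summable_coeffDist_bound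

lemma tendsto_linSeries {α₀ : ℝ} (hα₀ : IsParam α₀) (hev : ∀ᶠ α in 𝓝 α₀, IsParam α) {w : ℂ}
    (hw : ‖w‖ ≤ 1 / 10 ^ 5) :
    Tendsto (fun α => linSeries (2 * α) w) (𝓝 α₀) (𝓝 (linSeries (2 * α₀) w)) := by
  refine tendsto_tsum_of_dominated_convergence
    (bound := fun n => 1 / 10 ^ 5 * (2400 * (1 / 10 ^ 5)) ^ n) ?_ ?_ ?_
  · exact (summable_geometric_of_lt_one (by norm_num) (by norm_num)).mul_left _
  · intro n
    have h := continuousAt_linCoeff (fun n => (hα₀.two_mul_pow_sub_neg n).2) n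
    have h2 : ContinuousAt (fun α : ℝ => linCoeff (2 * α) n) α₀ :=
      ContinuousAt.comp' (f := fun α : ℝ => 2 * α) h (by fun_prop)
    exact ((continuous_ofReal.continuousAt.tendsto.comp h2)).mul_const _
  · filter_upwards [hev] with α hα n
    exact norm_linSeries_term_le hα.abs_linCoeff_le (by norm_num) n hw

lemma continuousAt_koenigsCritVal {α₀ : ℝ} (hα₀ : IsParam α₀) (hev : ∀ᶠ α in 𝓝 α₀, IsParam α) :
    ContinuousAt koenigsCritVal α₀ := by
  have hsmall : ∀ {α}, IsParam α → ‖koenigsCritVal α‖ ≤ 1 / 10 ^ 5 := fun hα =>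
    (koenigsCritVal_bounds hα).2.trans (by norm_num)
  have h1 := tendsto_linSeries hα₀ hev (hsmall hα₀)
  rw [linSeries_koenigsCritVal hα₀] at h1
  have h2 : Tendsto (fun α : ℝ => -(α : ℂ) ^ 2) (𝓝 α₀) (𝓝 (-(α₀ : ℂ) ^ 2)) :=
    Continuous.tendsto (by fun_prop) α₀
  have h3 := ((h2.sub h1).norm).const_mul 2
  rw [sub_self, norm_zero, mul_zero] at h3
  refine tendsto_iff_norm_sub_tendsto_zero.2
    (squeeze_zero' (Eventually.of_forall fun _ => norm_nonneg _) ?_ h3)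
  filter_upwards [hev] with α hα
  have := hα.nearId.le_norm_sub (hsmall hα) (hsmall hα₀)
  rw [linSeries_koenigsCritVal hα] at this
  linarith [norm_nonneg (koenigsCritVal α - koenigsCritVal α₀)]

lemma tendsto_coeffDist {α₀ : ℝ} (hα₀ : IsParam α₀) (hev : ∀ᶠ α in 𝓝 α₀, IsParam α) :
    Tendsto (fun α => coeffDist α₀ α) (𝓝 α₀) (𝓝 0) := by
  have : (∑' n : ℕ, (0 : ℝ)) = 0 := tsum_zero
  rw [← this]
  refine tendsto_tsum_of_dominated_convergence summable_coeffDist_bound ?_ ?_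
  · intro n
    have h := continuousAt_linCoeff (fun n => (hα₀.two_mul_pow_sub_neg n).2) n
    have h2 : ContinuousAt (fun α : ℝ => linCoeff (2 * α) n) α₀ :=
      ContinuousAt.comp' (f := fun α : ℝ => 2 * α) h (by fun_prop)
    have h3 : ContinuousAt (fun α => critCoeff α n) α₀ :=
      (ContinuousAt.comp' (f := fun α : ℝ => linCoeff (2 * α) n)
        continuous_ofReal.continuousAt h2).mul ((continuousAt_koenigsCritVal hα₀ hev).pow _)
    have h4 : ContinuousAt (fun α => ((n : ℝ) + 1) * ‖critCoeff α₀ n - critCoeff α n‖ * 4 ^ n) α₀ :=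
      by fun_prop
    simpa [ContinuousAt] using h4
  · filter_upwards [hev] with α hα n
    rw [Real.norm_of_nonneg (by positivity)]
    exact coeffDist_term_le hα₀ hα n

end CoeffDist

/-- The exponent of the stretching that conjugates multiplication by `2 * α` to multiplication by
`2 * α'`. -/
noncomputable def stretchExp (α α' : ℝ) : ℝ := Real.log (2 * α') / Real.log (2 * α)

/-- A conjugacy between `quad α` and `quad α'` near the attracting fixed points that matches
the critical values. -/
noncomputable def localConj (α α' : ℝ) (z : ℂ) : ℂ :=
  α' + linSeries (2 * α') (koenigsCritVal α' *
    powStretch (stretchExp α α') (koenigs α (z - α) / koenigsCritVal α))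

/-- Parameters that are close to each other. -/
structure CloseParams (ε : ℝ) (α α' : ℝ) : Prop where
  left : IsParam α
  right : IsParam α'
  stretchExp_near : |stretchExp α α' - 1| ≤ 1 / 20
  near : coeffDist α α' + |stretchExp α α' - 1| / 10 ^ 5 ≤ ε * (6 / 10 ^ 7)
  critVal_near : ‖critVal α' - critVal α‖ ≤ ε

lemma isParam_near : IsParam (1 / 1000) ∧ ∀ᶠ α in 𝓝 (1 / 1000 : ℝ), IsParam α := by
  refine ⟨by constructor <;> norm_num, ?_⟩
  filter_upwards [Icc_mem_nhds (a := (9 / 10 ^ 4 : ℝ)) (b := 11 / 10 ^ 4) (x := 1 / 1000)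
    (by norm_num) (by norm_num)] with α hα
  exact hα

lemma eventually_closeParams {ε : ℝ} (hε : 0 < ε) :
    ∀ᶠ α in 𝓝 (1 / 1000 : ℝ), CloseParams ε (1 / 1000) α ∧ CloseParams ε α (1 / 1000) := by
  obtain ⟨h0, hev⟩ := isParam_near
  have hlog : Real.log (2 * (1 / 1000)) ≠ 0 :=
    (Real.log_neg (by norm_num) (by norm_num)).ne
  have hc : ContinuousAt (fun α : ℝ => Real.log (2 * α)) (1 / 1000) :=
    ContinuousAt.log (by fun_prop) (by norm_num)
  have e1 : ContinuousAt (fun α => stretchExp (1 / 1000) α) (1 / 1000) := hc.div_const _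
  have e2 : ContinuousAt (fun α => stretchExp α (1 / 1000)) (1 / 1000) :=
    continuousAt_const.div hc hlog
  have hs : stretchExp (1 / 1000) (1 / 1000) = 1 := div_self hlog
  have t1 : Tendsto (fun α => |stretchExp (1 / 1000) α - 1|) (𝓝 (1 / 1000)) (𝓝 0) := by
    have := (e1.sub_const 1).abs
    simp only [hs, sub_self, abs_zero] at this
    exact this
  have t2 : Tendsto (fun α => |stretchExp α (1 / 1000) - 1|) (𝓝 (1 / 1000)) (𝓝 0) := by
    have := (e2.sub_const 1).abs
    simp only [hs, sub_self, abs_zero] at this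
    exact this
  have td := tendsto_coeffDist h0 hev
  have n1 := td.add (t1.div_const (10 ^ 5))
  have n2 := td.add (t2.div_const (10 ^ 5))
  rw [zero_div, add_zero] at n1 n2
  have tc : Tendsto (fun α : ℝ => ‖critVal α - critVal (1 / 1000)‖) (𝓝 (1 / 1000)) (𝓝 0) := by
    have : ContinuousAt (fun α : ℝ => ‖critVal α - critVal (1 / 1000)‖) (1 / 1000) := by
      unfold critVal; fun_prop
    simpa [ContinuousAt] using this
  have hε' : 0 < ε * (6 / 10 ^ 7) := by positivity
  filter_upwards [hev, t1.eventually_le_const (show (0 : ℝ) < 1 / 20 by norm_num),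
    t2.eventually_le_const (show (0 : ℝ) < 1 / 20 by norm_num), n1.eventually_le_const hε',
    n2.eventually_le_const hε', tc.eventually_le_const hε] with α g1 g2 g3 g4 g5 g6
  exact ⟨⟨h0, g1, g2, g4, g6⟩,
    ⟨g1, h0, g3, by rwa [coeffDist_comm], by rwa [norm_sub_rev]⟩⟩

namespace CloseParams

variable {ε α α' : ℝ} {z : ℂ}

lemma stretchExp_pos (H : CloseParams ε α α') : 0 < stretchExp α α' := by
  have := abs_le.1 H.stretchExp_near
  linarith

lemma rpow_stretchExp (H : CloseParams ε α α') : (2 * α) ^ stretchExp α α' = 2 * α' := by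
  have h1 := H.left
  have h2 := H.right
  unfold IsParam at h1 h2
  norm_num at h1 h2
  exact Real.rpow_logb (by linarith) (by linarith) (by linarith)

/-- The quotient of Koenigs coordinates is well controlled near the attracting fixed point. -/
lemma norm_koenigs_div_le (H : CloseParams ε α α') (hz : ‖z - α‖ ≤ 2 / 10 ^ 6) :
    ‖koenigs α (z - α) / koenigsCritVal α‖ ≤ 31 / 10 := by
  have h1 := norm_koenigs_le H.left (hz.trans (by norm_num))
  have h2 := (koenigsCritVal_bounds H.left).1
  rw [norm_div, div_le_iff₀ (lt_of_lt_of_le (by norm_num) h2)]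
  norm_num at *
  linarith

lemma norm_powStretch_sub_self_le (H : CloseParams ε α α') {u : ℂ} (hu : ‖u‖ ≤ 31 / 10) :
    ‖powStretch (stretchExp α α') u - u‖ ≤ 4 * |stretchExp α α' - 1| * ‖u - 1‖ := by
  have := abs_le.1 H.stretchExp_near
  exact _root_.norm_powStretch_sub_self_le H.stretchExp_pos (by linarith) (by linarith)

lemma norm_powStretch_le (H : CloseParams ε α α') {u : ℂ} (hu : ‖u‖ ≤ 31 / 10) :
    ‖powStretch (stretchExp α α') u‖ ≤ 4 := by
  have h1 := H.norm_powStretch_sub_self_le hu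
  have h2 : ‖u - 1‖ ≤ 41 / 10 := (norm_sub_le _ _).trans (by rw [norm_one]; linarith)
  have h3 := norm_le_norm_add_norm_sub' (powStretch (stretchExp α α') u) u
  have h4 := H.stretchExp_near
  have h5 : 4 * |stretchExp α α' - 1| * ‖u - 1‖ ≤ 4 * (1 / 20) * (41 / 10) := by gcongr
  linarith

lemma norm_koenigsCritVal_mul_le (hα : IsParam α) {u : ℂ} (hu : ‖u‖ ≤ 4) :
    ‖koenigsCritVal α * u‖ ≤ 54 / 10 ^ 7 := by
  rw [norm_mul]
  calc ‖koenigsCritVal α‖ * ‖u‖ ≤ 135 / 10 ^ 8 * 4 := by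
        gcongr; exact (koenigsCritVal_bounds hα).2
    _ = _ := by norm_num

lemma continuousOn_localConj (H : CloseParams ε α α') :
    ContinuousOn (localConj α α') (closedBall (α : ℂ) (2 / 10 ^ 6)) := by
  have h1 : ContinuousOn (linSeries (2 * α')) (closedBall 0 (54 / 10 ^ 7)) :=
    (differentiableOn_linSeries H.right.abs_linCoeff_le (R := 1 / 10 ^ 5) (by norm_num)
      (by norm_num) (by norm_num)).continuousOn.mono (closedBall_subset_ball (by norm_num))
  have h2 : ContinuousOn (fun z : ℂ => koenigs α (z - α)) (closedBall (α : ℂ) (2 / 10 ^ 6)) := by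
    refine (continuousOn_koenigs H.left).comp (by fun_prop) fun z hz => ?_
    rw [mem_closedBall_iff_norm] at hz
    rw [mem_closedBall_zero_iff]
    exact hz.trans (by norm_num)
  refine continuousOn_const.add (h1.comp (continuousOn_const.mul
    ((continuous_powStretch H.stretchExp_pos).comp_continuousOn (h2.div_const _))) fun z hz => ?_)
  rw [mem_closedBall_iff_norm] at hz
  rw [mem_closedBall_zero_iff]
  exact norm_koenigsCritVal_mul_le H.right (H.norm_powStretch_le (H.norm_koenigs_div_le hz))

lemma localConj_fixed (H : CloseParams ε α α') : localConj α α' α = α' := by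
  simp [localConj, koenigs_zero H.left, powStretch_zero, linSeries_zero]

lemma localConj_quad (H : CloseParams ε α α') (hz : ‖z - α‖ ≤ 2 / 10 ^ 6) :
    localConj α α' (quad α z) = quad α' (localConj α α' z) := by
  have h1 : quad α z - α = (z - α) * ((z - α) + 2 * α) := by rw [quad_sub_fixed]; ring
  have h2 := norm_koenigsCritVal_mul_le H.right
    (H.norm_powStretch_le (H.norm_koenigs_div_le hz))
  have hpos : 0 < 2 * α := by
    have := H.left.1
    norm_num at this
    linarith
  rw [localConj, h1, koenigs_mul_add_sq H.left (hz.trans (by norm_num)), mul_div_assoc,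
    powStretch_mul_of_pos hpos, H.rpow_stretchExp, mul_left_comm,
    H.right.linSeries_mul (h2.trans (by norm_num)), localConj, quad]
  push_cast
  ring

lemma localConj_localConj (H : CloseParams ε α α') (hz : ‖z - α‖ ≤ 2 / 10 ^ 6) :
    localConj α' α (localConj α α' z) = z := by
  have h2 := norm_koenigsCritVal_mul_le H.right
    (H.norm_powStretch_le (H.norm_koenigs_div_le hz))
  have h3 := H.right.norm_linSeries_le (h2.trans (by norm_num))
  have hne : ∀ {α}, IsParam α → koenigsCritVal α ≠ 0 := fun hα =>
    norm_pos_iff.1 (lt_of_lt_of_le (by norm_num) (koenigsCritVal_bounds hα).1)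
  have hs : stretchExp α' α = (stretchExp α α')⁻¹ := by rw [stretchExp, stretchExp, inv_div]
  rw [localConj, localConj, add_sub_cancel_left,
    koenigs_eq H.right (h3.trans (by norm_num at h2 ⊢; linarith)) (h2.trans (by norm_num)) rfl,
    mul_div_cancel_left₀ _ (hne H.right), hs, powStretch_inv_powStretch H.stretchExp_pos,
    mul_div_cancel₀ _ (hne H.left), (koenigs_spec H.left (hz.trans (by norm_num))).2]
  ring

lemma norm_localConj_sub_le (H : CloseParams ε α α') (hz : ‖z - α‖ ≤ 2 / 10 ^ 6) :
    ‖(localConj α α' z - critVal α') - (z - critVal α)‖ ≤ ε * ‖z - critVal α‖ := by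
  set u := koenigs α (z - α) / koenigsCritVal α with hu_def
  have hu := H.norm_koenigs_div_le hz
  rw [← hu_def] at hu
  have hSu := H.norm_powStretch_le hu
  have hu4 : ‖u‖ ≤ 4 := hu.trans (by norm_num)
  have hne : koenigsCritVal α ≠ 0 :=
    norm_pos_iff.1 (lt_of_lt_of_le (by norm_num) (koenigsCritVal_bounds H.left).1)
  have hwu : koenigsCritVal α * u = koenigs α (z - α) := mul_div_cancel₀ _ hne
  have hcv : ∀ {α}, IsParam α → critVal α = α + linSeries (2 * α) (koenigsCritVal α * 1) := by
    intro α hα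
    rw [mul_one, linSeries_koenigsCritVal hα, critVal]; ring
  have hz' : z = α + linSeries (2 * α) (koenigsCritVal α * u) := by
    rw [hwu, (koenigs_spec H.left (hz.trans (by norm_num))).2]; ring
  have hseries : ∀ {α}, IsParam α → ∀ v : ℂ,
      linSeries (2 * α) (koenigsCritVal α * v) = ∑' n, critCoeff α n * v ^ (n + 1) := by
    intro α hα v
    simp only [linSeries, critCoeff, mul_pow, mul_assoc]
  have hsum : ∀ {α}, IsParam α → ∀ {v : ℂ}, ‖v‖ ≤ 4 →
      Summable fun n => critCoeff α n * v ^ (n + 1) := by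
    intro α hα v hv
    have := (summable_linSeries hα.abs_linCoeff_le (R := 1 / 10 ^ 5) (by norm_num) (by norm_num)
      (by norm_num) ((norm_koenigsCritVal_mul_le hα hv).trans (by norm_num))).of_norm
    simpa only [critCoeff, mul_pow, mul_assoc] using this
  have one4 : ‖(1 : ℂ)‖ ≤ 4 := by norm_num
  have hdiff : ∀ v : ℂ, ‖v‖ ≤ 4 →
      linSeries (2 * α) (koenigsCritVal α * v) - linSeries (2 * α') (koenigsCritVal α' * v) =
      ∑' n, (critCoeff α n - critCoeff α' n) * v ^ (n + 1) := by
    intro v hv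
    rw [hseries H.left, hseries H.right, ← (hsum H.left hv).tsum_sub (hsum H.right hv)]
    simp only [sub_mul]
  have hA := (norm_tsum_pow_sub_tsum_pow_le (by norm_num)
    (summable_coeffDist H.left H.right) hu4 one4).2
  rw [← hdiff u hu4, ← hdiff 1 one4] at hA
  have hB := H.right.nearId.norm_sub_le
    ((norm_koenigsCritVal_mul_le H.right hSu).trans (by norm_num))
    ((norm_koenigsCritVal_mul_le H.right hu4).trans (by norm_num))
  rw [← mul_sub, norm_mul] at hB
  have hC := H.left.nearId.le_norm_sub
    ((norm_koenigsCritVal_mul_le H.left hu4).trans (by norm_num))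
    ((norm_koenigsCritVal_mul_le H.left one4).trans (by norm_num))
  rw [← mul_sub, norm_mul] at hC
  have hD : z - critVal α = linSeries (2 * α) (koenigsCritVal α * u) -
      linSeries (2 * α) (koenigsCritVal α * 1) := by
    rw [hcv H.left]; linear_combination hz'
  have hsub : (localConj α α' z - critVal α') - (z - critVal α) =
      (linSeries (2 * α') (koenigsCritVal α' * powStretch (stretchExp α α') u) -
        linSeries (2 * α') (koenigsCritVal α' * u)) -
      (linSeries (2 * α) (koenigsCritVal α * u) - linSeries (2 * α') (koenigsCritVal α' * u) -
        (linSeries (2 * α) (koenigsCritVal α * 1) -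
          linSeries (2 * α') (koenigsCritVal α' * 1))) := by
    rw [hD, localConj, ← hu_def, hcv H.right]; ring
  have hS := H.norm_powStretch_sub_self_le hu
  have hN := H.near
  obtain ⟨k1, k2⟩ := koenigsCritVal_bounds H.left
  obtain ⟨k3, k4⟩ := koenigsCritVal_bounds H.right
  have hE : 11 / 10 * (‖koenigsCritVal α'‖ * ‖powStretch (stretchExp α α') u - u‖) ≤
      11 / 10 * (135 / 10 ^ 8 * (4 * |stretchExp α α' - 1| * ‖u - 1‖)) := by gcongr
  have hε : 0 ≤ ε := (norm_nonneg _).trans H.critVal_near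
  have hF : ε * (9 / 10 * (73 / 10 ^ 8 * ‖u - 1‖)) ≤ ε * ‖z - critVal α‖ := by
    rw [hD]
    refine mul_le_mul_of_nonneg_left (le_trans ?_ hC) hε
    gcongr
  rw [hsub]
  refine (norm_sub_le _ _).trans ((add_le_add (hB.trans hE) hA).trans (le_trans ?_ hF))
  rw [← coeffDist]
  have := mul_le_mul_of_nonneg_right hN (norm_nonneg (u - 1))
  have hp : 0 ≤ |stretchExp α α' - 1| * ‖u - 1‖ := by positivity
  have hq : 0 ≤ ε * ‖u - 1‖ := by positivity
  norm_num at this ⊢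
  nlinarith

end CloseParams

/-- A Cauchy sequence with geometric rate converges to a continuous limit. -/
lemma exists_continuous_limit {f : ℕ → ℂ → ℂ} {C r : ℝ} (hr0 : 0 ≤ r) (hr : r < 1)
    (hf : ∀ n, Continuous (f n)) (hd : ∀ n z, ‖f (n + 1) z - f n z‖ ≤ C * r ^ n) :
    ∃ g : ℂ → ℂ, Continuous g ∧ ∀ z, Tendsto (fun n => f n z) atTop (𝓝 (g z)) := by
  have hd' : ∀ z n, dist (f n z) (f (n + 1) z) ≤ C * r ^ n := fun z n => by
    rw [dist_comm, dist_eq_norm]; exact hd n z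
  choose g hg using fun z => cauchySeq_tendsto_of_complete
    (cauchySeq_of_le_geometric r C hr (hd' z))
  refine ⟨g, ?_, hg⟩
  refine TendstoUniformly.continuous (F := f) (p := atTop) ?_ (Frequently.of_forall hf)
  rw [Metric.tendstoUniformly_iff]
  intro e he
  have h1 : Tendsto (fun n : ℕ => C * r ^ n / (1 - r)) atTop (𝓝 0) := by
    simpa using ((tendsto_pow_atTop_nhds_zero_of_lt_one hr0 hr).const_mul C).div_const (1 - r)
  filter_upwards [h1.eventually_lt_const he] with n hn z
  rw [dist_comm]
  exact (dist_le_of_le_geometric_of_tendsto r C hr (hd' z) (hg z) n).trans_lt hn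

namespace IsParam

variable {α : ℝ} {z : ℂ}

lemma norm_eq (hα : IsParam α) : ‖(α : ℂ)‖ = α := by
  have := hα.1
  norm_num at this
  rw [norm_real, Real.norm_of_nonneg (by linarith)]

lemma norm_quad_sub_le (hα : IsParam α) (hz : ‖z - α‖ ≤ 7 / 10) :
    ‖quad α z - α‖ ≤ 3 / 4 * ‖z - α‖ := by
  have h1 : ‖z + α‖ ≤ 3 / 4 := by
    have h2 : ‖z + α‖ ≤ ‖z - α‖ + ‖(2 : ℂ) * α‖ := by
      simpa [show z - α + 2 * α = z + α by ring] using norm_add_le (z - α) (2 * α)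
    have h3 := hα.2
    rw [norm_mul, hα.norm_eq] at h2
    norm_num at h2 h3
    linarith
  rw [quad_sub_fixed, norm_mul, mul_comm]
  gcongr

lemma norm_quad_iterate_sub_le (hα : IsParam α) (hz : ‖z - α‖ ≤ 7 / 10) (n : ℕ) :
    ‖(quad α)^[n] z - α‖ ≤ (3 / 4) ^ n * (7 / 10) := by
  induction n with
  | zero => simpa using hz
  | succ n ih =>
    rw [Function.iterate_succ_apply']
    have h1 : ((3 : ℝ) / 4) ^ n ≤ 1 := pow_le_one₀ (by norm_num) (by norm_num)
    refine (hα.norm_quad_sub_le (by linarith)).trans ?_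
    rw [pow_succ]
    linarith

lemma le_norm_of_lt_norm_sub (hα : IsParam α) (hz : 7 / 10 < ‖z - α‖) : 69 / 100 ≤ ‖z‖ := by
  have h1 := norm_sub_le z α
  have h2 := hα.2
  rw [hα.norm_eq] at h1
  norm_num at h2
  linarith

end IsParam

/-- A continuous map of the plane that is `δ`-close to the identity and extends the local
conjugacy. -/
structure ExtendsLocalConj (α α' δ : ℝ) (h : ℂ → ℂ) : Prop where
  continuous : Continuous h
  norm_sub_le : ∀ z, ‖h z - z‖ ≤ δ
  eq_localConj : ∀ z : ℂ, ‖z - α‖ ≤ 2 / 10 ^ 6 → h z = localConj α α' z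

namespace CloseParams

variable {ε α α' δ : ℝ} {h g : ℂ → ℂ} {z : ℂ}

lemma nonneg (H : CloseParams ε α α') : 0 ≤ ε := (norm_nonneg _).trans H.critVal_near

lemma norm_fixed_sub_critVal (hα : IsParam α) : ‖(α : ℂ) - critVal α‖ ≤ 121 / 10 ^ 8 := by
  rw [critVal, sub_sub_cancel, ← norm_neg]
  exact (norm_neg_sq_bounds hα).2

lemma norm_localConj_sub_self_le (H : CloseParams ε α α') (hz : ‖z - α‖ ≤ 2 / 10 ^ 6) :
    ‖localConj α α' z - z‖ ≤ 2 * ε := by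
  have h1 := H.norm_localConj_sub_le hz
  have h2 := H.critVal_near
  have h3 : ‖z - critVal α‖ ≤ ‖z - α‖ + ‖(α : ℂ) - critVal α‖ :=
    norm_sub_le_norm_sub_add_norm_sub ..
  have h4 := norm_fixed_sub_critVal H.left
  have h5 : ‖localConj α α' z - z‖ ≤
      ‖(localConj α α' z - critVal α') - (z - critVal α)‖ + ‖critVal α' - critVal α‖ := by
    refine le_trans (le_of_eq ?_) (norm_add_le _ _)
    congr 1; ring
  have h6 : ε * ‖z - critVal α‖ ≤ ε * 1 := by
    refine mul_le_mul_of_nonneg_left ?_ H.nonneg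
    norm_num at *
    linarith
  linarith

lemma exists_extendsLocalConj (H : CloseParams ε α α') :
    ∃ h, ExtendsLocalConj α α' (2 * ε) h := by
  set clamp : ℂ → ℂ := fun z =>
    α + ((2 / 10 ^ 6 / max (2 / 10 ^ 6) ‖z - α‖ : ℝ) : ℂ) * (z - α) with hclamp_def
  have hpos : ∀ z : ℂ, 0 < max (2 / 10 ^ 6 : ℝ) ‖z - α‖ := fun z =>
    lt_max_of_lt_left (by norm_num)
  have hclamp : ∀ z, ‖clamp z - α‖ ≤ 2 / 10 ^ 6 := by
    intro z
    have hp := hpos z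
    rw [hclamp_def]
    simp only
    rw [add_sub_cancel_left, norm_mul, norm_real, Real.norm_of_nonneg (by positivity),
      div_mul_eq_mul_div, div_le_iff₀ hp]
    gcongr
    exact le_max_right _ _
  have hclamp_cont : Continuous clamp := by
    refine continuous_const.add ((continuous_ofReal.comp ?_).mul (by fun_prop))
    exact continuous_const.div (by fun_prop) fun z => (hpos z).ne'
  have hc := H.continuousOn_localConj.comp_continuous hclamp_cont
    (fun z => by rw [mem_closedBall_iff_norm]; exact hclamp z)
  refine ⟨fun z => z + (localConj α α' (clamp z) - clamp z), ⟨?_, fun z => ?_, fun z hz => ?_⟩⟩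
  · exact continuous_id.add (hc.sub hclamp_cont)
  · rw [add_sub_cancel_left]
    exact H.norm_localConj_sub_self_le (hclamp z)
  · have : clamp z = z := by
      rw [hclamp_def]
      simp only
      rw [max_eq_left hz, div_self (by norm_num)]
      simp
    simp only [this]
    ring

lemma nearTranslation (H : CloseParams ε α α') (A : ExtendsLocalConj α α' δ h) (hεδ : ε ≤ δ) :
    NearTranslation α α' (3 * 10 ^ 6 * δ) h := by
  intro w
  have hε := H.nonneg
  rcases le_or_gt ‖w - α‖ (2 / 10 ^ 6) with hw | hw
  · rw [A.eq_localConj w hw]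
    refine (H.norm_localConj_sub_le hw).trans ?_
    gcongr
    linarith
  · have h1 := A.norm_sub_le w
    have h2 := H.critVal_near
    have h3 := norm_fixed_sub_critVal H.left
    have h4 : ‖w - α‖ ≤ ‖w - critVal α‖ + ‖(α : ℂ) - critVal α‖ := by
      rw [norm_sub_rev (α : ℂ)]; exact norm_sub_le_norm_sub_add_norm_sub ..
    have h5 : ‖(h w - critVal α') - (w - critVal α)‖ ≤ ‖h w - w‖ + ‖critVal α' - critVal α‖ := by
      refine le_trans (le_of_eq ?_) (norm_sub_le _ _)
      congr 1; ring
    have h6 : 7 / 10 ^ 7 ≤ ‖w - critVal α‖ := by norm_num at *; linarith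
    have h7 : 3 * 10 ^ 6 * δ * (7 / 10 ^ 7) ≤ 3 * 10 ^ 6 * δ * ‖w - critVal α‖ := by
      have : 0 ≤ δ := by linarith
      gcongr
    norm_num at h7 ⊢
    linarith

lemma extendsLocalConj_quadLift (H : CloseParams ε α α') (A : ExtendsLocalConj α α' δ h)
    (hεδ : ε ≤ δ) (hδ : 3 * 10 ^ 6 * δ ≤ 1 / 10) :
    ExtendsLocalConj α α' (3 * 10 ^ 6 * δ) (quadLift α α' h) := by
  have hε := H.nonneg
  have T := H.nearTranslation A hεδ
  refine ⟨continuous_quadLift T (by linarith) A.continuous, fun z => ?_, fun z hz => ?_⟩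
  · rcases le_or_gt ‖z‖ 1 with h1 | h1
    · refine (norm_quadLift_sub_le T (by linarith) z).trans ?_
      exact mul_le_of_le_one_right (by linarith) h1
    · have h2 := norm_quadLift_sub_mul_le T hδ z
      have h3 := A.norm_sub_le (quad α z)
      have h4 := H.critVal_near
      have h5 : ‖quadLift α α' h z - z‖ * 1 ≤ ‖quadLift α α' h z - z‖ * (9 / 5 * ‖z‖) := by
        gcongr
        linarith
      linarith
  · symm
    have hq : ‖quad α z - α‖ ≤ 2 / 10 ^ 6 := by
      have := H.left.norm_quad_sub_le (hz.trans (by norm_num))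
      linarith [norm_nonneg (z - α)]
    refine eq_quadLift T (by linarith) ?_ ?_
    · rw [A.eq_localConj _ hq, H.localConj_quad hz, quad_sub_critVal]
    · have h1 := H.norm_localConj_sub_self_le hz
      have h2 : ‖(α : ℂ)‖ ≤ ‖z‖ + ‖z - α‖ := by
        simpa using norm_sub_le z (z - α)
      have h3 := H.left.1
      rw [H.left.norm_eq] at h2
      norm_num at *
      linarith

lemma exists_extendsLocalConj_quadLift_eq (H : CloseParams ε α α') (n : ℕ)
    (hn : (3 * 10 ^ 6) ^ (n + 1) * (2 * ε) ≤ 1 / 10) :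
    ∃ h, ExtendsLocalConj α α' ((3 * 10 ^ 6) ^ n * (2 * ε)) h ∧
      ∀ z, ‖(quad α)^[n] z - α‖ ≤ 2 / 10 ^ 6 → quadLift α α' h z = h z := by
  have hε := H.nonneg
  have hle : ∀ n : ℕ, ε ≤ (3 * 10 ^ 6) ^ n * (2 * ε) := fun n => by
    have : (1 : ℝ) ≤ (3 * 10 ^ 6) ^ n := one_le_pow₀ (by norm_num)
    nlinarith
  induction n with
  | zero =>
    obtain ⟨h, A⟩ := H.exists_extendsLocalConj
    rw [zero_add, pow_one] at hn
    refine ⟨h, by simpa using A, fun z hz => ?_⟩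
    rw [Function.iterate_zero_apply] at hz
    rw [(H.extendsLocalConj_quadLift A (by linarith) hn).eq_localConj z hz, A.eq_localConj z hz]
  | succ n ih =>
    have hn' : 3 * 10 ^ 6 * ((3 * 10 ^ 6) ^ n * (2 * ε)) ≤ 1 / 10 := by
      refine le_trans ?_ hn
      rw [← mul_assoc, ← pow_succ', pow_succ _ (n + 1)]
      have : (0 : ℝ) ≤ (3 * 10 ^ 6) ^ (n + 1) * (2 * ε) := by positivity
      nlinarith
    obtain ⟨h, A, hA⟩ := ih (by rw [pow_succ', mul_assoc]; exact hn')
    refine ⟨quadLift α α' h, ?_, fun z hz => ?_⟩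
    · rw [pow_succ', mul_assoc]
      exact H.extendsLocalConj_quadLift A (hle n) hn'
    · exact quadLift_congr (hA _ hz)

lemma exists_conj (H : CloseParams ε α α') (hε : (3 * 10 ^ 6) ^ 51 * (2 * ε) ≤ 1 / 10) :
    ∃ h : ℂ → ℂ, Continuous h ∧ (∀ z, h (quad α z) = quad α' (h z)) ∧
      (∀ z, ‖h z - z‖ ≤ 1 / 10 * ‖z‖) ∧ (∀ z, ‖h z - z‖ ≤ 1 / 10) ∧
      ∀ z : ℂ, ‖z - α‖ ≤ 2 / 10 ^ 6 → h z = localConj α α' z := by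
  obtain ⟨g, A, hg⟩ := H.exists_extendsLocalConj_quadLift_eq 50 hε
  have hε0 := H.nonneg
  set δ := (3 * 10 ^ 6) ^ 50 * (2 * ε) with hδ_def
  have hδK : 3 * 10 ^ 6 * δ ≤ 1 / 10 := by rw [hδ_def, ← mul_assoc, ← pow_succ']; exact hε
  have hεδ : 10 * ε ≤ δ := by
    have : (10 : ℝ) ≤ (3 * 10 ^ 6) ^ 50 := by norm_num
    nlinarith
  clear_value δ
  have hgB : ∀ z : ℂ, ‖z - α‖ ≤ 7 / 10 → quadLift α α' g z = g z := fun z hz =>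
    hg z ((H.left.norm_quad_iterate_sub_le hz 50).trans (by norm_num))
  have key : ∀ h, ExtendsLocalConj α α' δ h → (∀ z : ℂ, ‖z - α‖ ≤ 7 / 10 → h z = g z) →
      ExtendsLocalConj α α' δ (quadLift α α' h) ∧
        ∀ z : ℂ, ‖z - α‖ ≤ 7 / 10 → quadLift α α' h z = g z := by
    intro h B hB
    have T := H.nearTranslation B (by linarith)
    have hB' : ∀ z : ℂ, ‖z - α‖ ≤ 7 / 10 → quadLift α α' h z = g z := by
      intro z hz
      rw [← hgB z hz]
      refine quadLift_congr (hB _ ?_)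
      have := H.left.norm_quad_sub_le hz
      linarith [norm_nonneg (z - α)]
    refine ⟨⟨continuous_quadLift T (by linarith) B.continuous, fun z => ?_, fun z hz => ?_⟩, hB'⟩
    · rcases le_or_gt ‖z - α‖ (7 / 10) with hz | hz
      · rw [hB' z hz]; exact A.norm_sub_le z
      · have h1 := norm_quadLift_sub_mul_le T hδK z
        have h2 := B.norm_sub_le (quad α z)
        have h3 := H.critVal_near
        have h4 := H.left.le_norm_of_lt_norm_sub hz
        have h5 : ‖quadLift α α' h z - z‖ * (12 / 10) ≤
            ‖quadLift α α' h z - z‖ * (9 / 5 * ‖z‖) := by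
          gcongr
          linarith
        linarith
    · rw [hB' z (hz.trans (by norm_num)), A.eq_localConj z hz]
  have hit : ∀ n, ExtendsLocalConj α α' δ ((quadLift α α')^[n] g) ∧
      ∀ z : ℂ, ‖z - α‖ ≤ 7 / 10 → (quadLift α α')^[n] g z = g z := by
    intro n
    induction n with
    | zero => exact ⟨A, fun _ _ => rfl⟩
    | succ n ih => rw [Function.iterate_succ_apply']; exact key _ ih.1 ih.2
  have hT : ∀ n, NearTranslation α α' (3 * 10 ^ 6 * δ) ((quadLift α α')^[n] g) := fun n =>
    H.nearTranslation (hit n).1 (by linarith)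
  have hd : ∀ n z, ‖(quadLift α α')^[n + 1] g z - (quadLift α α')^[n] g z‖ ≤
      2 * δ * (5 / 6) ^ n := by
    intro n
    induction n with
    | zero =>
      intro z
      have h1 := (hit 1).1.norm_sub_le z
      have h2 := (hit 0).1.norm_sub_le z
      have h3 := norm_sub_le_norm_sub_add_norm_sub ((quadLift α α')^[1] g z) z
        ((quadLift α α')^[0] g z)
      rw [norm_sub_rev z] at h3
      rw [zero_add, pow_zero]
      linarith
    | succ n ih =>
      intro z
      rcases le_or_gt ‖z - α‖ (7 / 10) with hz | hz
      · rw [(hit _).2 z hz, (hit _).2 z hz, sub_self, norm_zero]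
        have : 0 ≤ δ := by linarith
        positivity
      · have h1 := norm_quadLift_sub_quadLift_le (hT (n + 1)) (hT n) hδK z
        rw [← Function.iterate_succ_apply' (quadLift α α'),
          ← Function.iterate_succ_apply' (quadLift α α')] at h1
        have h2 := ih (quad α z)
        have h4 := H.left.le_norm_of_lt_norm_sub hz
        have h5 : ‖(quadLift α α')^[n + 1 + 1] g z - (quadLift α α')^[n + 1] g z‖ * (6 / 5) ≤
            ‖(quadLift α α')^[n + 1 + 1] g z - (quadLift α α')^[n + 1] g z‖ * (9 / 5 * ‖z‖) := by
          gcongr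
          linarith
        rw [pow_succ]
        linarith
  obtain ⟨h, hc, hlim⟩ := exists_continuous_limit (by norm_num) (by norm_num)
    (fun n => (hit n).1.continuous) hd
  have hlim' : ∀ z, Tendsto (fun n => (quadLift α α')^[n + 1] g z) atTop (𝓝 (h z)) := fun z =>
    (hlim z).comp (tendsto_add_atTop_nat 1)
  refine ⟨h, hc, fun z => ?_, fun z => ?_, fun z => ?_, fun z hz => ?_⟩
  · have h1 := (hlim' z).pow 2
    have h2 := (hlim (quad α z)).sub_const (critVal α')
    have h3 : (fun n => (quadLift α α')^[n + 1] g z ^ 2) =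
        fun n => (quadLift α α')^[n] g (quad α z) - critVal α' := by
      funext n
      rw [Function.iterate_succ_apply', quadLift_sq (hT n) (by linarith)]
    rw [h3] at h1
    have h4 := tendsto_nhds_unique h1 h2
    rw [← quad_sub_critVal] at h4
    exact (sub_left_injective h4).symm
  · refine le_of_tendsto ((hlim' z).sub_const z).norm (Eventually.of_forall fun n => ?_)
    rw [Function.iterate_succ_apply']
    refine (norm_quadLift_sub_le (hT n) (by linarith) z).trans ?_
    gcongr
  · refine le_of_tendsto ((hlim z).sub_const z).norm (Eventually.of_forall fun n => ?_)
    refine ((hit n).1.norm_sub_le z).trans ?_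
    linarith
  · refine tendsto_nhds_unique (hlim z) ?_
    simp only [(hit _).1.eq_localConj z hz]
    exact tendsto_const_nhds

end CloseParams

/-- A map commuting with `quad α` that is close to the identity, and equal to it near the
attracting fixed point, is the identity. -/
lemma eq_self_of_commute_quad {α C : ℝ} (hα : IsParam α) {e : ℂ → ℂ}
    (he : ∀ z, e (quad α z) = quad α (e z)) (hrel : ∀ z, ‖e z - z‖ ≤ 1 / 4 * ‖z‖)
    (hC : ∀ z, ‖e z - z‖ ≤ C) (hloc : ∀ᶠ z in 𝓝 (α : ℂ), e z = z) (z : ℂ) : e z = z := by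
  have hback : ∀ z, e (quad α z) = quad α z → e z = z := by
    intro z hz
    rw [he] at hz
    rcases eq_or_ne z 0 with rfl | hz0
    · simpa using hrel 0
    · refine eq_of_sq_eq_sq_of_near (z := z) ?_ ?_ ?_
      · rw [← quad_sub_critVal α, hz, quad_sub_critVal]
      · linarith [hrel z, norm_nonneg z]
      · simpa using hz0
  have hB : ∀ z : ℂ, ‖z - α‖ ≤ 7 / 10 → e z = z := by
    intro z hz
    have hlim : Tendsto (fun n => (quad α)^[n] z) atTop (𝓝 (α : ℂ)) := by
      rw [tendsto_iff_norm_sub_tendsto_zero]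
      refine squeeze_zero (fun _ => norm_nonneg _) (hα.norm_quad_iterate_sub_le hz) ?_
      simpa using (tendsto_pow_atTop_nhds_zero_of_lt_one (r := (3 / 4 : ℝ)) (by norm_num)
        (by norm_num)).mul_const (7 / 10)
    obtain ⟨n, hn⟩ := (hlim.eventually hloc).exists
    clear hlim hz
    induction n generalizing z with
    | zero => exact hn
    | succ n ih => exact hback z (ih _ hn)
  have hC0 : 0 ≤ C := (norm_nonneg _).trans (hC 0)
  have hdecay : ∀ n : ℕ, ∀ z, ‖e z - z‖ ≤ C * (5 / 6) ^ n := by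
    intro n
    induction n with
    | zero => simpa using hC
    | succ n ih =>
      intro z
      rcases le_or_gt ‖z - α‖ (7 / 10) with hz | hz
      · rw [hB z hz, sub_self, norm_zero]; positivity
      · have h1 : (e z - z) * (e z + z) = e (quad α z) - quad α z := by
          rw [he]; simp only [quad]; ring
        have h2 := hα.le_norm_of_lt_norm_sub hz
        have h3 : ‖(2 : ℂ) * z‖ ≤ ‖e z + z‖ + ‖e z - z‖ := by
          refine le_trans (le_of_eq ?_) (norm_sub_le _ _)
          congr 1; ring
        rw [norm_mul] at h3
        norm_num at h3
        have h4 : 6 / 5 ≤ ‖e z + z‖ := by linarith [hrel z]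
        have h5 := ih (quad α z)
        rw [← h1, norm_mul] at h5
        have h6 := mul_le_mul_of_nonneg_left h4 (norm_nonneg (e z - z))
        rw [pow_succ]
        linarith
  have hlim : Tendsto (fun n : ℕ => C * (5 / 6 : ℝ) ^ n) atTop (𝓝 0) := by
    simpa using (tendsto_pow_atTop_nhds_zero_of_lt_one (r := (5 / 6 : ℝ)) (by norm_num)
      (by norm_num)).const_mul C
  exact sub_eq_zero.1 (norm_le_zero_iff.1 (ge_of_tendsto' hlim fun n => hdecay n z))

/-- Quadratic polynomials with close parameters are conjugate by a homeomorphism close to the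
identity. -/
lemma exists_homeomorph_conj {ε α α' : ℝ} (H : CloseParams ε α α') (H' : CloseParams ε α' α)
    (hε : (3 * 10 ^ 6) ^ 51 * (2 * ε) ≤ 1 / 10) :
    ∃ h : ℂ ≃ₜ ℂ, (∀ z, h (quad α z) = quad α' (h z)) ∧ ∀ z, ‖h z - z‖ ≤ 1 / 10 * ‖z‖ := by
  have key : ∀ {α α' : ℝ} {h k : ℂ → ℂ}, CloseParams ε α α' → Continuous h →
      (∀ z, h (quad α z) = quad α' (h z)) → (∀ z, ‖h z - z‖ ≤ 1 / 10 * ‖z‖) →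
      (∀ z, ‖h z - z‖ ≤ 1 / 10) → (∀ z : ℂ, ‖z - α‖ ≤ 2 / 10 ^ 6 → h z = localConj α α' z) →
      (∀ z, k (quad α' z) = quad α (k z)) → (∀ z, ‖k z - z‖ ≤ 1 / 10 * ‖z‖) →
      (∀ z, ‖k z - z‖ ≤ 1 / 10) → (∀ z : ℂ, ‖z - α'‖ ≤ 2 / 10 ^ 6 → k z = localConj α' α z) →
      ∀ z, k (h z) = z := by
    intro α α' h k H hc h1 h2 h3 h4 k1 k2 k3 k4
    have htri : ∀ z, ‖k (h z) - z‖ ≤ ‖k (h z) - h z‖ + ‖h z - z‖ := fun z =>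
      norm_sub_le_norm_sub_add_norm_sub ..
    refine eq_self_of_commute_quad (C := 1 / 5) H.left (fun z => by rw [h1, k1]) (fun z => ?_)
      (fun z => ?_) ?_
    · have := norm_le_norm_add_norm_sub' (h z) z
      linarith [htri z, h2 z, k2 (h z), norm_nonneg z]
    · linarith [htri z, h3 z, k3 (h z)]
    · have hα : h (α : ℂ) = α' := by rw [h4 _ (by norm_num), H.localConj_fixed]
      have e1 : ∀ᶠ z : ℂ in 𝓝 (α : ℂ), ‖h z - α'‖ ≤ 2 / 10 ^ 6 := by
        have : Tendsto (fun z : ℂ => ‖h z - α'‖) (𝓝 (α : ℂ)) (𝓝 ‖h (α : ℂ) - α'‖) :=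
          Continuous.tendsto (by fun_prop) _
        rw [hα, sub_self, norm_zero] at this
        exact this.eventually_le_const (by norm_num)
      have e2 : ∀ᶠ z : ℂ in 𝓝 (α : ℂ), ‖z - α‖ ≤ 2 / 10 ^ 6 := by
        filter_upwards [closedBall_mem_nhds (α : ℂ) (show (0 : ℝ) < 2 / 10 ^ 6 by norm_num)]
          with z hz
        exact mem_closedBall_iff_norm.1 hz
      filter_upwards [e1, e2] with z hz1 hz2
      rw [k4 _ hz1, h4 _ hz2, H.localConj_localConj hz2]
  obtain ⟨h, hc, h1, h2, h3, h4⟩ := H.exists_conj hε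
  obtain ⟨k, kc, k1, k2, k3, k4⟩ := H'.exists_conj hε
  exact ⟨⟨⟨h, k, key H hc h1 h2 h3 h4 k1 k2 k3 k4, key H' kc k1 k2 k3 k4 h1 h2 h3 h4⟩, hc, kc⟩,
    h1, h2⟩

lemma tendsto_div_pow {ρ : ℝ} (hρ : 1 < ρ) (z : ℂ) :
    Tendsto (fun n : ℕ => z / (ρ : ℂ) ^ n) atTop (𝓝 0) := by
  rw [tendsto_zero_iff_norm_tendsto_zero]
  have h : ∀ n : ℕ, ‖z / (ρ : ℂ) ^ n‖ = ‖z‖ * ρ⁻¹ ^ n := fun n => by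
    rw [norm_div, norm_pow, norm_real, Real.norm_of_nonneg (by linarith), div_eq_mul_inv, inv_pow]
  simp only [h]
  simpa using (tendsto_pow_atTop_nhds_zero_of_lt_one (inv_nonneg.2 (by linarith))
    (inv_lt_one_of_one_lt₀ hρ)).const_mul ‖z‖

lemma forall_of_eventually_of_mul {ρ : ℝ} (hρ : 1 < ρ) {P : ℂ → Prop}
    (hloc : ∀ᶠ z in 𝓝 0, P z) (hstep : ∀ z, P z → P (ρ * z)) (z : ℂ) : P z := by
  obtain ⟨n, hn⟩ := ((tendsto_div_pow hρ z).eventually hloc).exists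
  have hρ0 : (ρ : ℂ) ≠ 0 := ofReal_ne_zero.2 (by linarith)
  induction n with
  | zero => simpa using hn
  | succ n ih =>
    refine ih ?_
    have := hstep _ hn
    rwa [pow_succ, ← div_div, mul_div_cancel₀ _ hρ0] at this

/-- The extension of `G`, defined on the closed ball of radius `r`, to a map of the plane
intertwining multiplication by `ρ` with `T`. -/
noncomputable def equivariantExt (ρ r : ℝ) (T G : ℂ → ℂ) (z : ℂ) : ℂ :=
  T^[sInf {n : ℕ | ‖z‖ ≤ r * ρ ^ n}] (G (z / (ρ : ℂ) ^ sInf {n : ℕ | ‖z‖ ≤ r * ρ ^ n}))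

section EquivariantExt

variable {ρ r : ℝ} {T G : ℂ → ℂ}

lemma exists_norm_lt_mul_pow (hρ : 1 < ρ) (hr : 0 < r) (z : ℂ) : ∃ n : ℕ, ‖z‖ < r * ρ ^ n := by
  obtain ⟨n, hn⟩ := pow_unbounded_of_one_lt (‖z‖ / r) hρ
  exact ⟨n, by rwa [div_lt_iff₀' hr] at hn⟩

lemma equivariantExt_eq (hρ : 1 < ρ) (hr : 0 < r)
    (hG : ∀ z, ‖(ρ : ℂ) * z‖ ≤ r → G (ρ * z) = T (G z)) {z : ℂ} {n : ℕ}
    (hn : ‖z‖ ≤ r * ρ ^ n) : equivariantExt ρ r T G z = T^[n] (G (z / (ρ : ℂ) ^ n)) := by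
  have hρ0 : (ρ : ℂ) ≠ 0 := ofReal_ne_zero.2 (by linarith)
  have hmem : sInf {n : ℕ | ‖z‖ ≤ r * ρ ^ n} ∈ {n : ℕ | ‖z‖ ≤ r * ρ ^ n} := Nat.sInf_mem ⟨n, hn⟩
  have hle : sInf {n : ℕ | ‖z‖ ≤ r * ρ ^ n} ≤ n := Nat.sInf_le hn
  rw [equivariantExt]
  generalize sInf {n : ℕ | ‖z‖ ≤ r * ρ ^ n} = m at hmem hle ⊢
  clear hn
  induction n, hle using Nat.le_induction with
  | base => rfl
  | succ n hmn ih =>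
    have h1 : z / (ρ : ℂ) ^ n = ρ * (z / (ρ : ℂ) ^ (n + 1)) := by
      rw [pow_succ]; field_simp
    have h2 : ‖z / (ρ : ℂ) ^ n‖ ≤ r := by
      rw [norm_div, norm_pow, norm_real, Real.norm_of_nonneg (by linarith),
        div_le_iff₀ (by positivity)]
      refine hmem.trans ?_
      gcongr
      exact hρ.le
    rw [ih, Function.iterate_succ_apply, ← hG _ (h1 ▸ h2), ← h1]

lemma equivariantExt_of_norm_le (hρ : 1 < ρ) (hr : 0 < r)
    (hG : ∀ z, ‖(ρ : ℂ) * z‖ ≤ r → G (ρ * z) = T (G z)) {z : ℂ} (hz : ‖z‖ ≤ r) :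
    equivariantExt ρ r T G z = G z := by
  rw [equivariantExt_eq hρ hr hG (n := 0) (by simpa using hz)]
  simp

lemma equivariantExt_mul (hρ : 1 < ρ) (hr : 0 < r)
    (hG : ∀ z, ‖(ρ : ℂ) * z‖ ≤ r → G (ρ * z) = T (G z)) (z : ℂ) :
    equivariantExt ρ r T G (ρ * z) = T (equivariantExt ρ r T G z) := by
  have hρ0 : (ρ : ℂ) ≠ 0 := ofReal_ne_zero.2 (by linarith)
  obtain ⟨n, hn⟩ := exists_norm_lt_mul_pow hρ hr z
  have hn' : ‖(ρ : ℂ) * z‖ ≤ r * ρ ^ (n + 1) := by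
    rw [norm_mul, norm_real, Real.norm_of_nonneg (by linarith), pow_succ, ← mul_assoc, mul_comm]
    gcongr
  rw [equivariantExt_eq hρ hr hG hn', equivariantExt_eq hρ hr hG hn.le,
    Function.iterate_succ_apply', pow_succ', mul_div_mul_left _ _ hρ0]

lemma equivariantExt_eventuallyEq (hρ : 1 < ρ) (hr : 0 < r)
    (hG : ∀ z, ‖(ρ : ℂ) * z‖ ≤ r → G (ρ * z) = T (G z)) {z : ℂ} {n : ℕ}
    (hn : ‖z‖ < r * ρ ^ n) :
    equivariantExt ρ r T G =ᶠ[𝓝 z] fun z => T^[n] (G (z / (ρ : ℂ) ^ n)) := by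
  filter_upwards [continuous_norm.continuousAt.eventually_lt_const hn] with w hw
  exact equivariantExt_eq hρ hr hG hw.le

lemma norm_div_pow_lt (hρ : 1 < ρ) {z : ℂ} {n : ℕ} (hn : ‖z‖ < r * ρ ^ n) :
    ‖z / (ρ : ℂ) ^ n‖ < r := by
  rwa [norm_div, norm_pow, norm_real, Real.norm_of_nonneg (by linarith),
    div_lt_iff₀ (by positivity)]

lemma continuous_equivariantExt (hρ : 1 < ρ) (hr : 0 < r)
    (hG : ∀ z, ‖(ρ : ℂ) * z‖ ≤ r → G (ρ * z) = T (G z)) (hT : Continuous T)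
    (hGc : ContinuousOn G (ball 0 r)) : Continuous (equivariantExt ρ r T G) := by
  rw [continuous_iff_continuousAt]
  intro z
  obtain ⟨n, hn⟩ := exists_norm_lt_mul_pow hρ hr z
  refine ContinuousAt.congr ?_ (equivariantExt_eventuallyEq hρ hr hG hn).symm
  have h1 : ContinuousAt G (z / (ρ : ℂ) ^ n) :=
    hGc.continuousAt (isOpen_ball.mem_nhds (mem_ball_zero_iff.2 (norm_div_pow_lt hρ hn)))
  have h2 : ContinuousAt (fun z : ℂ => G (z / (ρ : ℂ) ^ n)) z :=
    ContinuousAt.comp' (f := fun z : ℂ => z / (ρ : ℂ) ^ n) h1 (by fun_prop)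
  exact (hT.iterate n).continuousAt.comp' h2

lemma differentiable_equivariantExt (hρ : 1 < ρ) (hr : 0 < r)
    (hG : ∀ z, ‖(ρ : ℂ) * z‖ ≤ r → G (ρ * z) = T (G z)) (hT : Differentiable ℂ T)
    (hGd : DifferentiableOn ℂ G (ball 0 r)) : Differentiable ℂ (equivariantExt ρ r T G) := by
  intro z
  obtain ⟨n, hn⟩ := exists_norm_lt_mul_pow hρ hr z
  refine DifferentiableAt.congr_of_eventuallyEq ?_ (equivariantExt_eventuallyEq hρ hr hG hn)
  have h1 : DifferentiableAt ℂ G (z / (ρ : ℂ) ^ n) :=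
    hGd.differentiableAt (isOpen_ball.mem_nhds (mem_ball_zero_iff.2 (norm_div_pow_lt hρ hn)))
  have h2 : Differentiable ℂ T^[n] := hT.iterate n
  exact (h2 _).comp z (DifferentiableAt.comp z h1 (by fun_prop))

end EquivariantExt

/-- The multiplier of `quad α` at its repelling fixed point `1 - α`. -/
noncomputable def repMult (α : ℝ) : ℝ := 2 * (1 - α)

/-- The entire map that linearizes `quad α` at its repelling fixed point. -/
noncomputable def linearizer (α : ℝ) : ℂ → ℂ :=
  equivariantExt (repMult α) (1 / 160) (quad α) fun z => (1 - α) + linSeries (repMult α) z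

namespace IsParam

variable {α : ℝ}

lemma repMult_bounds (hα : IsParam α) : 199 / 100 < repMult α ∧ repMult α < 2 := by
  obtain ⟨h1, h2⟩ := hα
  norm_num at h1 h2
  rw [repMult]
  constructor <;> linarith

lemma one_lt_repMult (hα : IsParam α) : 1 < repMult α := by linarith [hα.repMult_bounds.1]

lemma repMult_pow_sub (hα : IsParam α) (n : ℕ) :
    1 ≤ 1 * |repMult α ^ (n + 2) - repMult α| ∧ repMult α ^ (n + 2) - repMult α ≠ 0 := by
  have h1 := hα.repMult_bounds.1
  have h2 : repMult α ^ 1 ≤ repMult α ^ (n + 1) := pow_le_pow_right₀ (by linarith) (by omega)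
  have h3 : repMult α ^ (n + 2) - repMult α = repMult α * (repMult α ^ (n + 1) - 1) := by ring
  have h4 : 1 ≤ repMult α ^ (n + 2) - repMult α := by rw [h3]; nlinarith
  exact ⟨by rw [one_mul]; exact h4.trans (le_abs_self _), by linarith⟩

lemma abs_linCoeff_repMult_le (hα : IsParam α) (n : ℕ) : |linCoeff (repMult α) n| ≤ 4 ^ n := by
  simpa using _root_.abs_linCoeff_le (by norm_num) (fun n => (hα.repMult_pow_sub n).1) n

lemma linearizer_aux (hα : IsParam α) (z : ℂ) (hz : ‖(repMult α : ℂ) * z‖ ≤ 1 / 160) :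
    (1 - α : ℂ) + linSeries (repMult α) (repMult α * z) =
      quad α ((1 - α) + linSeries (repMult α) z) := by
  have h1 : ‖z‖ ≤ 1 / 160 := by
    refine le_trans ?_ hz
    rw [norm_mul, norm_real]
    refine le_mul_of_one_le_left (norm_nonneg _) ?_
    exact hα.one_lt_repMult.le.trans (le_abs_self _)
  rw [_root_.linSeries_mul hα.abs_linCoeff_repMult_le (by norm_num) (by norm_num) (by norm_num)
    (fun n => (hα.repMult_pow_sub n).2) h1 hz, quad]
  have h2 : (repMult α : ℂ) = 2 * (1 - α) := by rw [repMult]; push_cast; ring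
  rw [h2]
  ring

lemma linearizer_mul (hα : IsParam α) (z : ℂ) :
    linearizer α (repMult α * z) = quad α (linearizer α z) :=
  equivariantExt_mul hα.one_lt_repMult (by norm_num) hα.linearizer_aux z

lemma linearizer_pow_mul (hα : IsParam α) (n : ℕ) (z : ℂ) :
    linearizer α ((repMult α : ℂ) ^ n * z) = (quad α)^[n] (linearizer α z) := by
  induction n with
  | zero => simp
  | succ n ih =>
    rw [pow_succ', mul_assoc, hα.linearizer_mul, ih, Function.iterate_succ_apply']

lemma linearizer_of_norm_le (hα : IsParam α) {z : ℂ} (hz : ‖z‖ ≤ 1 / 160) :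
    linearizer α z = (1 - α) + linSeries (repMult α) z :=
  equivariantExt_of_norm_le hα.one_lt_repMult (by norm_num) hα.linearizer_aux hz

lemma linearizer_zero (hα : IsParam α) : linearizer α 0 = 1 - α := by
  rw [hα.linearizer_of_norm_le (by norm_num), linSeries_zero, add_zero]

lemma differentiable_linearizer (hα : IsParam α) : Differentiable ℂ (linearizer α) := by
  refine differentiable_equivariantExt hα.one_lt_repMult (by norm_num) hα.linearizer_aux ?_ ?_
  · unfold quad; fun_prop
  · exact (differentiableOn_linSeries hα.abs_linCoeff_repMult_le (by norm_num) (by norm_num)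
      (by norm_num)).const_add _

lemma nearId_linearizer (hα : IsParam α) : NearId (linearizer α) (1 / 160) := by
  intro z w hz hw
  have := nearId_linSeries hα.abs_linCoeff_repMult_le (by norm_num)
    (by norm_num : (0 : ℝ) ≤ 1 / 160) (by norm_num) z w hz hw
  rwa [hα.linearizer_of_norm_le hz, hα.linearizer_of_norm_le hw, add_sub_add_left_eq_sub]

lemma linearizer_ne_const (hα : IsParam α) : ¬ ∀ z, linearizer α z = linearizer α 0 := by
  intro h
  have := hα.nearId_linearizer.injOn (z := 1 / 160) (w := 0) (by norm_num) (by norm_num) (h _)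
  norm_num at this

lemma transcendentalEntire_linearizer (hα : IsParam α) : TranscendentalEntire (linearizer α) := by
  refine ⟨hα.differentiable_linearizer, ?_⟩
  rintro ⟨p, hp⟩
  have hρ0 : (repMult α : ℂ) ≠ 0 := ofReal_ne_zero.2 (by linarith [hα.one_lt_repMult])
  have h1 : p.comp (Polynomial.C (repMult α : ℂ) * Polynomial.X) =
      p ^ 2 + Polynomial.C ((α : ℂ) - α ^ 2) := by
    refine Polynomial.funext fun z => ?_
    have := hα.linearizer_mul z
    rw [hp, hp, quad] at this
    simpa using this
  have h2 := congrArg Polynomial.natDegree h1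
  rw [Polynomial.natDegree_comp, Polynomial.natDegree_C_mul_X _ hρ0, Polynomial.natDegree_add_C,
    Polynomial.natDegree_pow] at h2
  obtain ⟨c, rfl⟩ := Polynomial.natDegree_eq_zero.1 (show p.natDegree = 0 by omega)
  exact hα.linearizer_ne_const fun z => by rw [hp, hp]; simp

lemma exists_three_le_norm_linearizer (hα : IsParam α) : ∃ z, 3 ≤ ‖linearizer α z‖ := by
  by_contra! h
  refine hα.linearizer_ne_const fun z => ?_
  refine hα.differentiable_linearizer.apply_eq_apply_of_bounded ?_ z 0
  rw [isBounded_iff_forall_norm_le]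
  exact ⟨3, by rintro _ ⟨z, rfl⟩; exact (h z).le⟩

end IsParam

lemma logPlus_le_logPlus {x y : ℝ} (hx : 0 ≤ x) (hxy : x ≤ y) : logPlus x ≤ logPlus y := by
  rcases hx.eq_or_lt with rfl | hx
  · simp [logPlus]
  · exact max_le_max le_rfl (Real.log_le_log hx hxy)

lemma logPlus_nonneg (x : ℝ) : 0 ≤ logPlus x := le_max_left _ _

lemma log_le_logPlus (x : ℝ) : Real.log x ≤ logPlus x := le_max_right _ _

lemma tendsto_affine_div_affine (a b d : ℝ) {c : ℝ} (hc : c ≠ 0) :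
    Tendsto (fun t : ℝ => (a * t + b) / (c * t + d)) atTop (𝓝 (a / c)) := by
  have h1 : Tendsto (fun t : ℝ => (a + b / t) / (c + d / t)) atTop (𝓝 ((a + 0) / (c + 0))) := by
    refine Tendsto.div ?_ ?_ (by simpa using hc)
    · exact tendsto_const_nhds.add (tendsto_const_nhds.div_atTop tendsto_id)
    · exact tendsto_const_nhds.add (tendsto_const_nhds.div_atTop tendsto_id)
  rw [add_zero, add_zero] at h1
  refine h1.congr' ?_
  filter_upwards [eventually_gt_atTop 0] with t ht
  rw [← mul_div_mul_right (a + b / t) (c + d / t) ht.ne']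
  congr 1 <;> field_simp

namespace IsParam

variable {α : ℝ}

lemma critVal_norm_le (hα : IsParam α) : ‖(α : ℂ) - α ^ 2‖ ≤ 12 / 10 ^ 4 := by
  obtain ⟨h1, h2⟩ := hα
  norm_num at h1 h2
  rw [← ofReal_pow, ← ofReal_sub, norm_real, Real.norm_of_nonneg (by nlinarith)]
  norm_num
  nlinarith

lemma norm_quad_add_two_le (hα : IsParam α) (w : ℂ) : ‖quad α w‖ + 2 ≤ (‖w‖ + 2) ^ 2 := by
  have h1 := norm_add_le (w ^ 2) ((α : ℂ) - α ^ 2)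
  have h2 := hα.critVal_norm_le
  rw [norm_pow] at h1
  rw [quad]
  nlinarith [norm_nonneg w]

lemma norm_quad_iterate_add_two_le (hα : IsParam α) (n : ℕ) (w : ℂ) :
    ‖(quad α)^[n] w‖ + 2 ≤ (‖w‖ + 2) ^ 2 ^ n := by
  induction n with
  | zero => simp
  | succ n ih =>
    rw [Function.iterate_succ_apply', pow_succ 2, pow_mul]
    exact (hα.norm_quad_add_two_le _).trans (by gcongr)

lemma le_norm_quad_iterate (hα : IsParam α) (n : ℕ) {w : ℂ} (hw : 3 ≤ ‖w‖) :
    2 * (3 / 2 : ℝ) ^ 2 ^ n ≤ ‖(quad α)^[n] w‖ := by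
  induction n with
  | zero =>
    simp only [pow_zero, pow_one, Function.iterate_zero_apply]
    linarith
  | succ n ih =>
    rw [Function.iterate_succ_apply', pow_succ 2, pow_mul, quad]
    generalize (quad α)^[n] w = v at ih
    have h1 : ‖v ^ 2‖ ≤ ‖v ^ 2 + ((α : ℂ) - α ^ 2)‖ + ‖(α : ℂ) - α ^ 2‖ := by
      have := norm_sub_le (v ^ 2 + ((α : ℂ) - α ^ 2)) ((α : ℂ) - α ^ 2)
      rwa [add_sub_cancel_right] at this
    have h2 := hα.critVal_norm_le
    rw [norm_pow] at h1
    have h3 : (1 : ℝ) ≤ (3 / 2 : ℝ) ^ 2 ^ n := one_le_pow₀ (by norm_num)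
    nlinarith

lemma log_repMult_pos (hα : IsParam α) : 0 < Real.log (repMult α) :=
  Real.log_pos hα.one_lt_repMult

lemma logPlus_logPlus_linearizer_le (hα : IsParam α) {z : ℂ} (hz : 1 < ‖z‖) :
    logPlus (logPlus ‖linearizer α z‖) ≤
      Real.log 2 / Real.log (repMult α) * Real.log ‖z‖ +
        (Real.log 160 / Real.log (repMult α) + 2) * Real.log 2 := by
  have hρ := hα.one_lt_repMult
  have hlog := hα.log_repMult_pos
  have hρ0 : (repMult α : ℂ) ≠ 0 := ofReal_ne_zero.2 (by linarith)
  have h2 : 0 < Real.log 2 := Real.log_pos (by norm_num)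
  set x := Real.log (160 * ‖z‖) / Real.log (repMult α) with hx
  have hx0 : 0 ≤ x := div_nonneg (Real.log_nonneg (by linarith)) hlog.le
  have hn1 : (⌈x⌉₊ : ℝ) ≤ x + 1 := (Nat.ceil_lt_add_one hx0).le
  have hn2 : x ≤ ⌈x⌉₊ := Nat.le_ceil x
  generalize ⌈x⌉₊ = n at hn1 hn2
  have hpow : 160 * ‖z‖ ≤ repMult α ^ n := by
    rw [hx, div_le_iff₀ hlog, ← Real.log_pow] at hn2
    exact (Real.log_le_log_iff (by positivity) (by positivity)).1 hn2
  have hsmall : ‖z / (repMult α : ℂ) ^ n‖ ≤ 1 / 160 := by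
    rw [norm_div, norm_pow, norm_real, Real.norm_of_nonneg (by linarith),
      div_le_iff₀ (by positivity)]
    linarith
  have hL0 : ‖linearizer α (z / (repMult α : ℂ) ^ n)‖ ≤ 2 := by
    have h3 := hα.nearId_linearizer.norm_sub_le hsmall (w := 0) (by norm_num)
    rw [hα.linearizer_zero, sub_zero] at h3
    have h4 : ‖(1 : ℂ) - α‖ ≤ 1 := by
      obtain ⟨h1, h2⟩ := hα
      norm_num at h1 h2
      rw [← ofReal_one, ← ofReal_sub, norm_real, Real.norm_of_nonneg (by linarith)]
      linarith
    have h5 := norm_le_norm_add_norm_sub' (linearizer α (z / (repMult α : ℂ) ^ n)) (1 - α)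
    linarith
  have hL : ‖linearizer α z‖ ≤ 4 ^ 2 ^ n := by
    have h3 := hα.linearizer_pow_mul n (z / (repMult α : ℂ) ^ n)
    rw [mul_div_cancel₀ _ (pow_ne_zero n hρ0)] at h3
    have h4 := hα.norm_quad_iterate_add_two_le n (linearizer α (z / (repMult α : ℂ) ^ n))
    rw [← h3] at h4
    have h5 : (‖linearizer α (z / (repMult α : ℂ) ^ n)‖ + 2) ^ 2 ^ n ≤ (4 : ℝ) ^ 2 ^ n := by
      gcongr
      linarith
    linarith
  have h3 : logPlus ‖linearizer α z‖ ≤ 2 ^ (n + 1) := by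
    refine (logPlus_le_logPlus (norm_nonneg _) hL).trans (max_le (by positivity) ?_)
    rw [Real.log_pow, show (4 : ℝ) = 2 ^ 2 by norm_num, Real.log_pow, pow_succ]
    have := Real.log_two_lt_d9
    push_cast
    gcongr
    linarith
  have h4 : logPlus (logPlus ‖linearizer α z‖) ≤ (n + 1) * Real.log 2 := by
    refine (logPlus_le_logPlus (logPlus_nonneg _) h3).trans (max_le (by positivity) ?_)
    rw [Real.log_pow]
    push_cast
    exact le_rfl
  refine h4.trans ?_
  have h5 : x = Real.log 160 / Real.log (repMult α) + Real.log ‖z‖ / Real.log (repMult α) := by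
    rw [hx, Real.log_mul (by norm_num) (by linarith), add_div]
  calc (n + 1) * Real.log 2 ≤ (x + 2) * Real.log 2 :=
        mul_le_mul_of_nonneg_right (by linarith) h2.le
    _ = _ := by rw [h5]; ring

lemma le_logPlus_logPlus_linearizer (hα : IsParam α) {z : ℂ} (hz : 3 ≤ ‖linearizer α z‖) (n : ℕ) :
    Real.log 2 * n + Real.log (Real.log (3 / 2)) ≤
      logPlus (logPlus ‖linearizer α ((repMult α : ℂ) ^ n * z)‖) := by
  have h1 := hα.le_norm_quad_iterate n hz
  rw [← hα.linearizer_pow_mul] at h1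
  have hc : 0 < Real.log (3 / 2) := Real.log_pos (by norm_num)
  have h2 : 2 ^ n * Real.log (3 / 2) ≤
      logPlus ‖linearizer α ((repMult α : ℂ) ^ n * z)‖ := by
    refine le_trans ?_ (log_le_logPlus _)
    have h3 : ((3 : ℝ) / 2) ^ 2 ^ n ≤ ‖linearizer α ((repMult α : ℂ) ^ n * z)‖ :=
      le_trans (by linarith [pow_pos (show (0 : ℝ) < 3 / 2 by norm_num) (2 ^ n)]) h1
    have h4 := Real.log_le_log (by positivity) h3
    rw [Real.log_pow] at h4
    exact_mod_cast h4
  refine le_trans ?_ ((Real.log_le_log (by positivity) h2).trans (log_le_logPlus _))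
  rw [Real.log_mul (by positivity) hc.ne', Real.log_pow, mul_comm]

/-- The order of the linearizer is governed by the multiplier of the repelling fixed point. -/
lemma entireOrder_linearizer (hα : IsParam α) :
    entireOrder (linearizer α) = ENNReal.ofReal (Real.log 2 / Real.log (repMult α)) := by
  have hρ := hα.one_lt_repMult
  have hlog := hα.log_repMult_pos
  have hlogz : Tendsto (fun z : ℂ => Real.log ‖z‖) (comap (fun z : ℂ => ‖z‖) atTop) atTop :=
    Real.tendsto_log_atTop.comp tendsto_comap
  have hne : NeBot (comap (fun z : ℂ => ‖z‖) atTop) := by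
    rw [comap_norm_atTop]; infer_instance
  apply le_antisymm
  · have h1 := (ENNReal.continuous_ofReal.tendsto _).comp
      ((tendsto_affine_div_affine (Real.log 2 / Real.log (repMult α))
        ((Real.log 160 / Real.log (repMult α) + 2) * Real.log 2) 0 one_ne_zero).comp hlogz)
    rw [div_one] at h1
    rw [← h1.limsup_eq]
    refine limsup_le_limsup ?_
    filter_upwards [tendsto_comap.eventually_gt_atTop 1] with z hz
    refine ENNReal.ofReal_le_ofReal ?_
    simp only [Function.comp_apply, one_mul, add_zero]
    have : 0 < Real.log ‖z‖ := Real.log_pos hz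
    gcongr
    exact hα.logPlus_logPlus_linearizer_le hz
  · obtain ⟨z, hz⟩ := hα.exists_three_le_norm_linearizer
    have hz0 : z ≠ 0 := by
      rintro rfl
      rw [hα.linearizer_zero] at hz
      have := norm_sub_le (1 : ℂ) α
      rw [hα.norm_eq, norm_one] at this
      have h2 := hα.2
      norm_num at h2
      linarith
    have hnorm : ∀ n : ℕ, ‖(repMult α : ℂ) ^ n * z‖ = repMult α ^ n * ‖z‖ := fun n => by
      rw [norm_mul, norm_pow, norm_real, Real.norm_of_nonneg (by linarith)]
    have hx : Tendsto (fun n : ℕ => (repMult α : ℂ) ^ n * z) atTop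
        (comap (fun z : ℂ => ‖z‖) atTop) := by
      rw [tendsto_comap_iff]
      simp only [Function.comp_def, hnorm]
      exact (tendsto_pow_atTop_atTop_of_one_lt hρ).atTop_mul_const (norm_pos_iff.2 hz0)
    have h1 := (ENNReal.continuous_ofReal.tendsto _).comp
      ((tendsto_affine_div_affine (Real.log 2) (Real.log (Real.log (3 / 2))) (Real.log ‖z‖)
        hlog.ne').comp tendsto_natCast_atTop_atTop)
    rw [← h1.limsup_eq]
    refine le_trans ?_ (limsup_le_limsup_of_le hx)
    rw [← limsup_comp]
    refine limsup_le_limsup ?_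
    filter_upwards [(hlogz.comp hx).eventually_gt_atTop 0] with n hn
    refine ENNReal.ofReal_le_ofReal ?_
    have h2 : Real.log ‖(repMult α : ℂ) ^ n * z‖ =
        Real.log (repMult α) * n + Real.log ‖z‖ := by
      rw [hnorm, Real.log_mul (by positivity) (norm_ne_zero_iff.2 hz0), Real.log_pow, mul_comm]
    simp only [Function.comp_apply] at hn ⊢
    rw [h2] at hn ⊢
    gcongr
    exact hα.le_logPlus_logPlus_linearizer hz n

end IsParam

/-- `f` has a continuous right inverse through `z` on the disk of radius `r` about `f z`. -/
def HasSectionAt (f : ℂ → ℂ) (z : ℂ) (r : ℝ) : Prop :=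
  ∃ σ : ℂ → ℂ, ContinuousOn σ (ball (f z) r) ∧ σ (f z) = z ∧ ∀ y ∈ ball (f z) r, f (σ y) = y

/-- `f` is injective near `z`. -/
def LocallyInjectiveAt (f : ℂ → ℂ) (z : ℂ) : Prop :=
  ∀ᶠ p : ℂ × ℂ in 𝓝 (z, z), f p.1 = f p.2 → p.1 = p.2

lemma NearId.hasSectionAt {f : ℂ → ℂ} {R r : ℝ} {z : ℂ} (hf : NearId f R) (hz : ‖z‖ ≤ R / 2)
    (hr : r ≤ 9 / 10 * (R / 2)) (hR : 0 < R) : HasSectionAt f z r := by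
  have hadd : ∀ ζ : ℂ, ‖ζ‖ ≤ R / 2 → ‖z + ζ‖ ≤ R := fun ζ hζ => by
    linarith [norm_add_le z ζ]
  have hshift : NearId (fun ζ => f (z + ζ)) (R / 2) := by
    intro ζ ξ hζ hξ
    simpa using hf (z + ζ) (z + ξ) (hadd ζ hζ) (hadd ξ hξ)
  have hex : ∀ y ∈ ball (f z) r, ∃ x, ‖x‖ ≤ R ∧ f x = y := by
    intro y hy
    rw [mem_ball, dist_eq_norm] at hy
    obtain ⟨ζ, h1, h2⟩ := hshift.exists_eq (y := y) (by positivity)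
      (by simpa using hy.le.trans hr)
    exact ⟨z + ζ, hadd ζ h1, h2⟩
  choose! σ h1 h2 using hex
  by_cases hr0 : 0 < r
  · refine ⟨σ, ?_, ?_, h2⟩
    · refine (LipschitzOnWith.of_dist_le_mul (K := 10 / 9) fun y hy w hw => ?_).continuousOn
      have := hf.le_norm_sub (h1 y hy) (h1 w hw)
      rw [h2 y hy, h2 w hw] at this
      rw [dist_eq_norm, dist_eq_norm]
      push_cast
      linarith
    · have hm := mem_ball_self (x := f z) hr0
      exact hf.injOn (h1 _ hm) (by linarith) (h2 _ hm)
  · rw [not_lt] at hr0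
    exact ⟨fun _ => z, by simp [ball_eq_empty.2 hr0], rfl, by simp [ball_eq_empty.2 hr0]⟩

lemma NearId.locallyInjectiveAt {f : ℂ → ℂ} {R : ℝ} {z : ℂ} (hf : NearId f R) (hz : ‖z‖ < R) :
    LocallyInjectiveAt f z := by
  have h : ∀ᶠ x : ℂ in 𝓝 z, ‖x‖ < R := continuous_norm.continuousAt.eventually_lt_const hz
  rw [LocallyInjectiveAt, nhds_prod_eq]
  filter_upwards [h.prod_mk h] with p hp
  exact hf.injOn hp.1.le hp.2.le

lemma LocallyInjectiveAt.comp {f g : ℂ → ℂ} {z : ℂ} (hg : LocallyInjectiveAt g (f z))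
    (hf : LocallyInjectiveAt f z) (hc : ContinuousAt f z) :
    LocallyInjectiveAt (fun x => g (f x)) z := by
  have h : Tendsto (fun p : ℂ × ℂ => (f p.1, f p.2)) (𝓝 (z, z)) (𝓝 (f z, f z)) := by
    rw [nhds_prod_eq, nhds_prod_eq]
    exact hc.tendsto.prodMap hc.tendsto
  filter_upwards [hf, h.eventually hg] with p h1 h2 h3
  exact h1 (h2 h3)

lemma locallyInjectiveAt_quad (α : ℝ) {v : ℂ} (hv : v ≠ 0) : LocallyInjectiveAt (quad α) v := by
  have h : ∀ᶠ x : ℂ in 𝓝 v, ‖x - v‖ < ‖v‖ / 2 := by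
    filter_upwards [ball_mem_nhds v (half_pos (norm_pos_iff.2 hv))] with x hx
    exact mem_ball_iff_norm.1 hx
  rw [LocallyInjectiveAt, nhds_prod_eq]
  filter_upwards [h.prod_mk h] with p hp hq
  refine eq_of_sq_eq_sq_of_near (z := v) ?_ hp.1.le ?_
  · rw [← quad_sub_critVal α, ← quad_sub_critVal α, hq]
  · linarith [hp.2, norm_nonneg v]

/-- Continuous branch of the inverse of `quad α` away from the critical value. -/
lemma exists_quad_section (α : ℝ) {v : ℂ} (hv : 83 / 100 ≤ ‖v‖) {r : ℝ} (hr : r ≤ 1 / 5) :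
    ∃ s : ℂ → ℂ, ContinuousOn s (ball (quad α v) r) ∧ s (quad α v) = v ∧
      (∀ y ∈ ball (quad α v) r, quad α (s y) = y) ∧
      MapsTo s (ball (quad α v) r) (ball v (4 / 5 * r)) := by
  have hv0 : v ≠ 0 := norm_pos_iff.1 (by linarith)
  have hv2 : 68 / 100 ≤ ‖v‖ ^ 2 := by nlinarith
  have hu : ∀ y, (y - critVal α) / v ^ 2 - 1 = (y - quad α v) / v ^ 2 := fun y => by
    have h1 := quad_sub_critVal α v
    have h2 : critVal α = quad α v - v ^ 2 := by rw [← h1]; ring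
    rw [h2]; field_simp; ring
  have hlt : ∀ y ∈ ball (quad α v) r, ‖(y - critVal α) / v ^ 2 - 1‖ ≤ 3 / 10 := by
    intro y hy
    rw [mem_ball, dist_eq_norm] at hy
    rw [hu, norm_div, norm_pow, div_le_iff₀ (by positivity)]
    nlinarith
  have hs2 : ∀ y ∈ ball (quad α v) r,
      (v * principalSqrt ((y - critVal α) / v ^ 2)) ^ 2 = y - critVal α := by
    intro y hy
    have h0 := ne_zero_of_norm_sub_one_lt ((hlt y hy).trans_lt (by norm_num))
    rw [mul_pow, principalSqrt_sq h0]
    field_simp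
  have hnear : ∀ y ∈ ball (quad α v) r,
      ‖v * principalSqrt ((y - critVal α) / v ^ 2) - v‖ ≤ 3 / 10 * ‖v‖ := by
    intro y hy
    have h1 := (norm_principalSqrt_sub_one_le ((hlt y hy).trans_lt (by norm_num))).trans (hlt y hy)
    rw [← mul_sub_one, norm_mul, mul_comm]
    gcongr
  refine ⟨fun y => v * principalSqrt ((y - critVal α) / v ^ 2), ?_, ?_, ?_, ?_⟩
  · intro y hy
    refine ContinuousAt.continuousWithinAt (ContinuousAt.mul continuousAt_const ?_)
    exact ContinuousAt.comp' (f := fun y : ℂ => (y - critVal α) / v ^ 2)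
      (continuousAt_principalSqrt ((hlt y hy).trans_lt (by norm_num))) (by fun_prop)
  · have h1 := norm_principalSqrt_sub_one_le (w := (quad α v - critVal α) / v ^ 2)
      (by rw [hu]; simp)
    rw [hu, sub_self, zero_div, norm_zero, norm_le_zero_iff, sub_eq_zero] at h1
    simp only [h1, mul_one]
  · intro y hy
    have h1 := quad_sub_critVal α (v * principalSqrt ((y - critVal α) / v ^ 2))
    rw [hs2 y hy] at h1
    exact sub_left_injective h1
  · intro y hy
    have h1 := hs2 y hy
    have h2 := hnear y hy
    rw [mem_ball_iff_norm] at hy ⊢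
    simp only
    generalize v * principalSqrt ((y - critVal α) / v ^ 2) = s at h1 h2
    have h3 : (s - v) * (s + v) = y - quad α v := by
      linear_combination h1 + quad_sub_critVal α v
    have h4 : 2 * ‖v‖ ≤ ‖s + v‖ + ‖s - v‖ := by
      have := norm_sub_le (s + v) (s - v)
      rw [show s + v - (s - v) = 2 * v by ring, norm_mul] at this
      simpa using this
    have h5 : ‖s - v‖ * ‖s + v‖ = ‖y - quad α v‖ := by rw [← norm_mul, h3]
    have h6 : 141 / 100 ≤ ‖s + v‖ := by linarith
    nlinarith [norm_nonneg (s - v)]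

namespace IsParam

variable {α : ℝ}

lemma linearizer_eq_quad_div (hα : IsParam α) (z : ℂ) :
    linearizer α z = quad α (linearizer α (z / repMult α)) := by
  have hρ0 : (repMult α : ℂ) ≠ 0 := ofReal_ne_zero.2 (by linarith [hα.one_lt_repMult])
  rw [← hα.linearizer_mul, mul_div_cancel₀ _ hρ0]

lemma le_norm_of_le_norm_quad (hα : IsParam α) {v : ℂ} (hv : 7 / 10 ≤ ‖quad α v‖) :
    83 / 100 ≤ ‖v‖ := by
  have h1 := norm_add_le (v ^ 2) ((α : ℂ) - α ^ 2)
  have h2 := hα.critVal_norm_le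
  rw [norm_pow, ← quad] at h1
  nlinarith [norm_nonneg v]

lemma norm_div_repMult_le (hα : IsParam α) {z : ℂ} {n : ℕ}
    (hz : ‖z‖ ≤ repMult α ^ (n + 1) / 320) : ‖z / (repMult α : ℂ)‖ ≤ repMult α ^ n / 320 := by
  have := hα.one_lt_repMult
  rw [norm_div, norm_real, Real.norm_of_nonneg (by linarith), div_le_iff₀ (by linarith)]
  rw [pow_succ] at hz
  linarith

lemma exists_norm_le_pow_div (hα : IsParam α) (z : ℂ) :
    ∀ᶠ n : ℕ in atTop, ‖z‖ ≤ repMult α ^ n / 320 := by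
  filter_upwards [(tendsto_pow_atTop_atTop_of_one_lt hα.one_lt_repMult).eventually_ge_atTop
    (320 * ‖z‖)] with n hn
  linarith

lemma locallyInjectiveAt_linearizer (hα : IsParam α) {z : ℂ} (hz : 7 / 10 ≤ ‖linearizer α z‖) :
    LocallyInjectiveAt (linearizer α) z := by
  obtain ⟨n, hn⟩ := (hα.exists_norm_le_pow_div z).exists
  induction n generalizing z with
  | zero =>
    refine hα.nearId_linearizer.locallyInjectiveAt ?_
    norm_num at hn ⊢
    linarith
  | succ n ih =>
    rw [funext hα.linearizer_eq_quad_div]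
    rw [hα.linearizer_eq_quad_div] at hz
    have hv := hα.le_norm_of_le_norm_quad hz
    have hρ0 : (repMult α : ℂ) ≠ 0 := ofReal_ne_zero.2 (by linarith [hα.one_lt_repMult])
    have hc := hα.differentiable_linearizer.continuous
    have h1 := ih (by linarith) (hα.norm_div_repMult_le hn)
    have h2 : LocallyInjectiveAt (fun x : ℂ => x / repMult α) z :=
      Eventually.of_forall fun p hp => (div_left_inj' hρ0).1 hp
    exact (locallyInjectiveAt_quad α (norm_pos_iff.1 (by linarith))).comp
      (f := fun x => linearizer α (x / repMult α))
      (LocallyInjectiveAt.comp (f := fun x : ℂ => x / repMult α) h1 h2 (by fun_prop))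
      (by fun_prop)

lemma hasSectionAt_linearizer_aux (hα : IsParam α) (n : ℕ) {z : ℂ}
    (hz : 7 / 10 ≤ ‖linearizer α z‖) (hn : ‖z‖ ≤ repMult α ^ n / 320) {r : ℝ} (hr : r ≤ 1 / 5)
    (hrn : (4 / 5) ^ n * r ≤ 9 / 3200) : HasSectionAt (linearizer α) z r := by
  induction n generalizing z r with
  | zero =>
    refine hα.nearId_linearizer.hasSectionAt ?_ ?_ (by norm_num)
    · norm_num at hn ⊢; linarith
    · norm_num at hrn ⊢; linarith
  | succ n ih =>
    have heq := hα.linearizer_eq_quad_div z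
    have hv := hα.le_norm_of_le_norm_quad (heq ▸ hz)
    have hρ0 : (repMult α : ℂ) ≠ 0 := ofReal_ne_zero.2 (by linarith [hα.one_lt_repMult])
    obtain ⟨s, s1, s2, s3, s4⟩ := exists_quad_section α hv hr
    obtain ⟨τ, t1, t2, t3⟩ := ih (by linarith) (hα.norm_div_repMult_le hn) (r := 4 / 5 * r)
      (by linarith) (by rw [pow_succ] at hrn; linarith)
    rw [HasSectionAt, heq]
    refine ⟨fun y => repMult α * τ (s y), ?_, ?_, ?_⟩
    · exact continuousOn_const.mul (t1.comp s1 s4)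
    · simp only [s2, t2, mul_div_cancel₀ _ hρ0]
    · intro y hy
      rw [hα.linearizer_mul, t3 _ (s4 hy), s3 y hy]

lemma hasSectionAt_linearizer (hα : IsParam α) {z : ℂ} (hz : 7 / 10 ≤ ‖linearizer α z‖) :
    HasSectionAt (linearizer α) z (1 / 5) := by
  have h : Tendsto (fun n : ℕ => (4 / 5 : ℝ) ^ n * (1 / 5)) atTop (𝓝 (0 * (1 / 5))) :=
    (tendsto_pow_atTop_nhds_zero_of_lt_one (by norm_num) (by norm_num)).mul_const _
  obtain ⟨n, h1, h2⟩ := ((hα.exists_norm_le_pow_div z).and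
    (h.eventually_le_const (u := 9 / 3200) (by norm_num))).exists
  exact hα.hasSectionAt_linearizer_aux n hz h1 le_rfl h2

end IsParam

/-- A point is a regular value as soon as all sections over a disk about it exist. -/
lemma isRegularValue_of_hasSectionAt {f : ℂ → ℂ} (hf : Continuous f) {w : ℂ} {r : ℝ} (hr : 0 < r)
    (hs : ∀ z, f z ∈ ball w r → HasSectionAt f z (2 * r))
    (hi : ∀ z, f z ∈ ball w r → LocallyInjectiveAt f z) : IsRegularValue f w := by
  refine ⟨ball w r, isOpen_ball, mem_ball_self hr, fun z hz => ?_⟩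
  obtain ⟨σ, h1, h2, h3⟩ := hs z hz
  have hsub : ball w r ⊆ ball (f z) (2 * r) := by
    intro y hy
    have hz' : dist (f z) w < r := hz
    have hy' : dist y w < r := hy
    rw [mem_ball]
    linarith [dist_triangle_right y (f z) w]
  have hσc : ContinuousOn σ (ball w r) := h1.mono hsub
  have hσr : ∀ y ∈ ball w r, f (σ y) = y := fun y hy => h3 y (hsub hy)
  have hopen : IsOpen (f ⁻¹' ball w r) := isOpen_ball.preimage hf
  have hσf : ∀ x ∈ f ⁻¹' ball w r, ContinuousAt (fun x => σ (f x)) x := fun x hx =>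
    ContinuousAt.comp' (hσc.continuousAt (isOpen_ball.mem_nhds hx)) hf.continuousAt
  have hV1 : ∀ y ∈ ball w r, σ y ∈ connectedComponentIn (f ⁻¹' ball w r) z := by
    intro y hy
    have himg : σ '' ball w r ⊆ connectedComponentIn (f ⁻¹' ball w r) z := by
      refine IsPreconnected.subset_connectedComponentIn ?_ ⟨f z, hz, h2⟩ ?_
      · exact ((convex_ball w r).isPreconnected).image σ hσc
      · rintro _ ⟨y, hy, rfl⟩
        rw [mem_preimage, hσr y hy]
        exact hy
    exact himg ⟨y, hy, rfl⟩
  have hVsub := connectedComponentIn_subset (f ⁻¹' ball w r) z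
  have hV2 : ∀ x ∈ connectedComponentIn (f ⁻¹' ball w r) z, σ (f x) = x := by
    have hA : IsOpen {x | x ∈ f ⁻¹' ball w r ∧ σ (f x) = x} := by
      rw [isOpen_iff_mem_nhds]
      rintro x ⟨hx, hx'⟩
      have ht : Tendsto (fun x' => (σ (f x'), x')) (𝓝 x) (𝓝 (x, x)) := by
        have := (hσf x hx).tendsto
        rw [hx'] at this
        exact this.prodMk_nhds tendsto_id
      filter_upwards [hopen.mem_nhds hx, ht.eventually (hi x hx)] with x' h4 h5
      exact ⟨h4, h5 (hσr _ h4)⟩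
    have hB : IsOpen {x | x ∈ f ⁻¹' ball w r ∧ σ (f x) ≠ x} := by
      rw [isOpen_iff_mem_nhds]
      rintro x ⟨hx, hx'⟩
      filter_upwards [hopen.mem_nhds hx, ((hσf x hx).prodMk continuousAt_id).eventually
        (isClosed_diagonal.isOpen_compl.mem_nhds hx')] with x' h4 h5
      exact ⟨h4, h5⟩
    have hsubset := isPreconnected_connectedComponentIn.subset_left_of_subset_union hA hB
      (disjoint_left.2 fun x hx hx' => hx'.2 hx.2)
      (s := connectedComponentIn (f ⁻¹' ball w r) z)
      (fun x hx => by
        by_cases h : σ (f x) = x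
        · exact Or.inl ⟨hVsub hx, h⟩
        · exact Or.inr ⟨hVsub hx, h⟩)
      ⟨z, mem_connectedComponentIn hz, hz, h2⟩
    exact fun x hx => (hsubset hx).2
  refine ⟨{ toFun := fun x => ⟨f x, hVsub x.2⟩
            invFun := fun y => ⟨σ y, hV1 y y.2⟩
            left_inv := fun x => Subtype.ext (hV2 x x.2)
            right_inv := fun y => Subtype.ext (hσr y y.2)
            continuous_toFun := by fun_prop
            continuous_invFun := (continuousOn_iff_continuous_domRestrict.1 hσc).subtype_mk _ },
    fun x => rfl⟩

lemma IsParam.isBounded_singularSet_linearizer {α : ℝ} (hα : IsParam α) :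
    Bornology.IsBounded (singularSet (linearizer α)) := by
  refine (isBounded_closedBall (x := (0 : ℂ)) (r := 4 / 5)).subset fun w hw => ?_
  by_contra h
  rw [mem_closedBall_zero_iff, not_le] at h
  have hlarge : ∀ z, linearizer α z ∈ ball w (1 / 10) → 7 / 10 ≤ ‖linearizer α z‖ := by
    intro z hz
    rw [mem_ball_comm, mem_ball, dist_eq_norm] at hz
    linarith [norm_sub_norm_le w (linearizer α z)]
  refine hw (isRegularValue_of_hasSectionAt hα.differentiable_linearizer.continuous (r := 1 / 10)
    (by norm_num) (fun z hz => ?_) fun z hz => hα.locallyInjectiveAt_linearizer (hlarge z hz))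
  norm_num
  exact hα.hasSectionAt_linearizer (hlarge z hz)

/-- `Φ` is a lift of `h` under the linearizers of `quad α` and `quad α'`. -/
structure LinearizerLift (α α' : ℝ) (h Φ : ℂ → ℂ) : Prop where
  continuous : Continuous Φ
  map_zero : Φ 0 = 0
  map_mul : ∀ z, Φ (repMult α * z) = repMult α' * Φ z
  semiconj : ∀ z, linearizer α' (Φ z) = h (linearizer α z)

lemma exists_linearizerLift {α α' : ℝ} {h : ℂ → ℂ} (hα : IsParam α) (hα' : IsParam α')
    (hc : Continuous h) (hq : ∀ z, h (quad α z) = quad α' (h z)) (hfix : h (1 - α) = 1 - α') :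
    ∃ Φ, LinearizerLift α α' h Φ := by
  have hρ := hα.one_lt_repMult
  have hL := hα.differentiable_linearizer.continuous
  have hL' := hα'.nearId_linearizer
  obtain ⟨σ, s1, s2, s3⟩ := hL'.hasSectionAt (z := 0) (r := 9 / 3200) (by norm_num)
    (by norm_num) (by norm_num)
  have h0 : h (linearizer α 0) = linearizer α' 0 := by
    rw [hα.linearizer_zero, hα'.linearizer_zero, hfix]
  have hcont : ContinuousAt (fun z => h (linearizer α z)) 0 := (hc.comp hL).continuousAt
  have hmem : ∀ᶠ z in 𝓝 (0 : ℂ), h (linearizer α z) ∈ ball (linearizer α' 0) (9 / 3200) := by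
    refine hcont.eventually (p := fun y => y ∈ ball (linearizer α' 0) (9 / 3200)) ?_
    simp only [h0]
    exact ball_mem_nhds _ (by norm_num)
  have hσ0 : ContinuousAt σ (h (linearizer α 0)) := by
    rw [h0]
    exact s1.continuousAt (ball_mem_nhds _ (by norm_num))
  have hsmall : ∀ᶠ z in 𝓝 (0 : ℂ), ‖σ (h (linearizer α z))‖ < 1 / 320 := by
    have h1 : ContinuousAt (fun z => σ (h (linearizer α z))) 0 := ContinuousAt.comp' hσ0 hcont
    refine h1.norm.eventually_lt_const ?_
    simp only [h0, s2]
    norm_num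
  obtain ⟨r, hr, hball⟩ := nhds_basis_closedBall.eventually_iff.1 (hmem.and hsmall)
  have hsec : ∀ z, ‖z‖ ≤ r → linearizer α' (σ (h (linearizer α z))) = h (linearizer α z) :=
    fun z hz => s3 _ (hball (mem_closedBall_zero_iff.2 hz)).1
  have hsml : ∀ z, ‖z‖ ≤ r → ‖σ (h (linearizer α z))‖ < 1 / 320 :=
    fun z hz => (hball (mem_closedBall_zero_iff.2 hz)).2
  have hG : ∀ z, ‖(repMult α : ℂ) * z‖ ≤ r →
      σ (h (linearizer α (repMult α * z))) = repMult α' * σ (h (linearizer α z)) := by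
    intro z hz
    have hz' : ‖z‖ ≤ r := by
      refine le_trans ?_ hz
      rw [norm_mul, norm_real]
      exact le_mul_of_one_le_left (norm_nonneg _) (hρ.le.trans (le_abs_self _))
    refine hL'.injOn ((hsml _ hz).le.trans (by norm_num)) ?_ ?_
    · have h1 := hα'.repMult_bounds
      rw [norm_mul, norm_real, Real.norm_of_nonneg (by linarith)]
      nlinarith [hsml z hz', norm_nonneg (σ (h (linearizer α z)))]
    · rw [hsec _ hz, hα.linearizer_mul, hα'.linearizer_mul, hsec _ hz', hq]
  have hnear : ∀ z, ‖z‖ ≤ r → equivariantExt (repMult α) r (fun w => repMult α' * w)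
      (fun z => σ (h (linearizer α z))) z = σ (h (linearizer α z)) :=
    fun z hz => equivariantExt_of_norm_le (T := fun w => repMult α' * w) hρ hr hG hz
  have hmul := equivariantExt_mul (T := fun w => repMult α' * w)
    (G := fun z => σ (h (linearizer α z))) hρ hr hG
  refine ⟨equivariantExt (repMult α) r (fun w => repMult α' * w)
    (fun z => σ (h (linearizer α z))), ?_, ?_, hmul, ?_⟩
  · refine continuous_equivariantExt hρ hr hG (by fun_prop) ?_
    refine s1.comp (hc.comp hL).continuousOn fun z hz => ?_
    exact (hball (ball_subset_closedBall hz)).1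
  · rw [hnear 0 (by simpa using hr.le), h0, s2]
  · refine forall_of_eventually_of_mul hρ ?_ fun z hz => ?_
    · filter_upwards [closedBall_mem_nhds (0 : ℂ) hr] with z hz
      rw [mem_closedBall_zero_iff] at hz
      rw [hnear z hz, hsec z hz]
    · rw [hmul, hα'.linearizer_mul, hz, hα.linearizer_mul, hq]

lemma LinearizerLift.leftInverse {α α' : ℝ} {h h' Φ Ψ : ℂ → ℂ} (hα : IsParam α)
    (hΦ : LinearizerLift α α' h Φ) (hΨ : LinearizerLift α' α h' Ψ)
    (hh : Function.LeftInverse h' h) : Function.LeftInverse Ψ Φ := by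
  refine forall_of_eventually_of_mul hα.one_lt_repMult ?_ fun z hz => ?_
  · have h1 : ∀ᶠ z in 𝓝 (0 : ℂ), ‖Ψ (Φ z)‖ < 1 / 160 := by
      refine ((hΨ.continuous.comp hΦ.continuous).norm.continuousAt).eventually_lt_const ?_
      simp [hΦ.map_zero, hΨ.map_zero]
    have h2 : ∀ᶠ z : ℂ in 𝓝 0, ‖z‖ < 1 / 160 :=
      continuous_norm.continuousAt.eventually_lt_const (by norm_num)
    filter_upwards [h1, h2] with z hz1 hz2
    refine hα.nearId_linearizer.injOn hz1.le hz2.le ?_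
    rw [hΨ.semiconj, hΦ.semiconj, hh]
  · rw [hΦ.map_mul, hΨ.map_mul, hz]

lemma topEquiv_linearizer {α α' : ℝ} (hα : IsParam α) (hα' : IsParam α') (h : ℂ ≃ₜ ℂ)
    (hq : ∀ z, h (quad α z) = quad α' (h z)) (hfix : h (1 - α) = 1 - α') :
    TopEquiv (linearizer α) (linearizer α') := by
  obtain ⟨Φ, hΦ⟩ := exists_linearizerLift hα hα' h.continuous hq hfix
  obtain ⟨Ψ, hΨ⟩ := exists_linearizerLift hα' hα h.symm.continuous
    (fun z => h.injective (by rw [hq, h.apply_symm_apply, h.apply_symm_apply]))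
    (by rw [← hfix, h.symm_apply_apply])
  exact ⟨{ toFun := Φ
           invFun := Ψ
           left_inv := hΦ.leftInverse hα hΨ h.symm_apply_apply
           right_inv := hΨ.leftInverse hα' hΦ h.apply_symm_apply
           continuous_toFun := hΦ.continuous
           continuous_invFun := hΨ.continuous }, h, fun z => (hΦ.semiconj z).symm⟩

lemma quad_repelling_fixed (α : ℝ) : quad α (1 - α) = 1 - α := by rw [quad]; ring

lemma map_repelling_fixed {α α' : ℝ} (hα : IsParam α) (hα' : IsParam α') {h : ℂ → ℂ}
    (hq : ∀ z, h (quad α z) = quad α' (h z)) (hn : ∀ z, ‖h z - z‖ ≤ 1 / 10 * ‖z‖) :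
    h (1 - α) = 1 - α' := by
  have h1 := hq (1 - α)
  rw [quad_repelling_fixed] at h1
  have h2 : (h (1 - α) - α') * (h (1 - α) - (1 - α')) = 0 := by
    rw [quad] at h1
    linear_combination -h1
  rcases mul_eq_zero.1 h2 with h3 | h3
  · exfalso
    have h4 := hn (1 - α)
    rw [sub_eq_zero.1 h3, norm_sub_rev] at h4
    obtain ⟨a1, a2⟩ := hα
    obtain ⟨b1, b2⟩ := hα'
    norm_num at a1 a2 b1 b2
    rw [← ofReal_one, ← ofReal_sub, ← ofReal_sub, norm_real, norm_real,
      Real.norm_of_nonneg (by linarith), Real.norm_of_nonneg (by linarith)] at h4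
    linarith
  · exact sub_eq_zero.1 h3

lemma entireOrder_linearizer_injective {α α' : ℝ} (hα : IsParam α) (hα' : IsParam α')
    (h : entireOrder (linearizer α) = entireOrder (linearizer α')) : α = α' := by
  have h2 : 0 < Real.log 2 := Real.log_pos (by norm_num)
  have l1 := hα.log_repMult_pos
  have l2 := hα'.log_repMult_pos
  have r1 := hα.one_lt_repMult
  have r2 := hα'.one_lt_repMult
  rw [hα.entireOrder_linearizer, hα'.entireOrder_linearizer,
    ENNReal.ofReal_eq_ofReal_iff (by positivity) (by positivity)] at h
  rw [div_eq_div_iff l1.ne' l2.ne', mul_right_inj' h2.ne'] at h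
  have h3 := Real.log_injOn_pos (mem_Ioi.2 (by linarith)) (mem_Ioi.2 (by linarith)) h.symm
  rw [repMult, repMult] at h3
  linarith

theorem noninvariance_of_order_in_class_B :
    ∃ f g : ℂ → ℂ, TranscendentalEntire f ∧ TranscendentalEntire g ∧
      Bornology.IsBounded (singularSet f) ∧ Bornology.IsBounded (singularSet g) ∧
      TopEquiv f g ∧
      entireOrder f ≠ ⊤ ∧ entireOrder g ≠ ⊤ ∧
      entireOrder f ≠ entireOrder g := by
  have hε : (0 : ℝ) < 1 / (20 * (3 * 10 ^ 6) ^ 51) := by positivity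
  obtain ⟨α, ⟨H, H'⟩, hne⟩ := (((eventually_closeParams hε).filter_mono
    (nhdsWithin_le_nhds (s := {(1 / 1000 : ℝ)}ᶜ))).and self_mem_nhdsWithin).exists
  obtain ⟨h, hq, hn⟩ := exists_homeomorph_conj H H' (by norm_num)
  have hα := H.left
  have hα' := H.right
  refine ⟨linearizer (1 / 1000), linearizer α, hα.transcendentalEntire_linearizer,
    hα'.transcendentalEntire_linearizer, hα.isBounded_singularSet_linearizer,
    hα'.isBounded_singularSet_linearizer,
    topEquiv_linearizer hα hα' h hq (map_repelling_fixed hα hα' hq hn), ?_, ?_, ?_⟩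
  · rw [hα.entireOrder_linearizer]
    exact ENNReal.ofReal_ne_top
  · rw [hα'.entireOrder_linearizer]
    exact ENNReal.ofReal_ne_top
  · exact fun he => hne (entireOrder_linearizer_injective hα hα' he).symm
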